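/- arXiv:1009.0931 — 6 statements merged into one kernel-verified Lean document; each statement's English description precedes it below -/
import Mathlib

section
/- Let N ≥ 2 be an integer, let γ > 0, and let Ω ⊆ P_γ ⊂ ℝ^N be an open set. Then for every v ∈ C_c^∞(Ω): ∫_Ω |∇v(x)|² dx ≥ (N²/4) ∫_Ω v(x)²/|x|² dx + γ(N−2) ∫_Ω v(x)²/(x_N − γ|x'|²) dx. -/
open Real MeasureTheory

/-- The last coordinate `x_N` of a point `x ∈ ℝ^N`. -/
noncomputable def lastCoord {N : ℕ} (x : EuclideanSpace ℝ (Fin N)) : ℝ :=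
  ∑ i : Fin N, if (i : ℕ) + 1 = N then x i else 0

/-- `|x'|²`, the squared Euclidean norm of the first `N-1` coordinates of `x`. -/
noncomputable def sqNormPrime {N : ℕ} (x : EuclideanSpace ℝ (Fin N)) : ℝ :=
  ∑ i : Fin N, if (i : ℕ) + 1 < N then (x i) ^ 2 else 0

/-- The paraboloid `P_γ = {x = (x', x_N) : x_N > γ |x'|²}`. -/
def paraboloid (N : ℕ) (γ : ℝ) : Set (EuclideanSpace ℝ (Fin N)) :=
  {x | γ * sqNormPrime x < lastCoord x}

open scoped ContDiff

lemma aux_contDiff {E : Type*} [NormedAddCommGroup E] [NormedSpace ℝ E] (u h : E → ℝ)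
    (hu : ContDiff ℝ 1 u) (hh : ∀ x ∈ tsupport u, ContDiffAt ℝ 1 h x) :
    ContDiff ℝ 1 (fun x => u x * h x) := by
  rw [contDiff_iff_contDiffAt]
  intro x
  by_cases hx : x ∈ tsupport u
  · exact hu.contDiffAt.mul (hh x hx)
  · have : (fun x => u x * h x) =ᶠ[nhds x] fun _ => 0 := by
      filter_upwards [notMem_tsupport_iff_eventuallyEq.mp hx] with y hy
      simp [hy]
    exact contDiffAt_const.congr_of_eventuallyEq this

lemma aux_int_zero {n : ℕ} (g : EuclideanSpace ℝ (Fin n) → ℝ) (hg : ContDiff ℝ 1 g)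
    (hc : HasCompactSupport g) (w : EuclideanSpace ℝ (Fin n)) :
    Integrable (fun x => fderiv ℝ g x w) ∧ ∫ x, fderiv ℝ g x w = 0 := by
  have h1 : Integrable (fun x => fderiv ℝ g x w) := by
    apply Continuous.integrable_of_hasCompactSupport
    · exact (hg.continuous_fderiv one_ne_zero).clm_apply continuous_const
    · exact hc.fderiv_apply (𝕜 := ℝ) w
  have h2 : Integrable g := hg.continuous.integrable_of_hasCompactSupport hc
  refine ⟨h1, ?_⟩
  have := integral_mul_fderiv_eq_neg_fderiv_mul_of_integrable (𝕜 := ℝ) (μ := volume)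
    (f := fun _ : EuclideanSpace ℝ (Fin n) => (1:ℝ)) (g := g) (v := w)
    (by simp) (by simpa using h1) (by simpa using h2) (by simp)
    (fun x _ => (hg.differentiable one_ne_zero).differentiableAt)
  simpa using this

lemma aux_last {n : ℕ} (x : EuclideanSpace ℝ (Fin (n+1))) : lastCoord x = x (Fin.last n) := by
  unfold lastCoord
  rw [Fin.sum_univ_castSucc]
  simp
  apply Finset.sum_eq_zero
  intro i _
  rw [if_neg (by have := i.2; omega)]

lemma aux_prime {n : ℕ} (x : EuclideanSpace ℝ (Fin (n+1))) :
    sqNormPrime x = ∑ i : Fin n, x i.castSucc ^ 2 := by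
  unfold sqNormPrime
  rw [Fin.sum_univ_castSucc]
  simp

/-- the derivative of the defining function -/
noncomputable def auxD {n : ℕ} (γ : ℝ) (x : EuclideanSpace ℝ (Fin (n+1))) (i : Fin (n+1)) : ℝ :=
  if i = Fin.last n then 1 else -2 * γ * x i

noncomputable def auxd {n : ℕ} (γ : ℝ) (x : EuclideanSpace ℝ (Fin (n+1))) : ℝ :=
  x (Fin.last n) - γ * ∑ i : Fin n, x i.castSucc ^ 2

noncomputable def auxF {n : ℕ} (γ : ℝ) (i : Fin (n+1)) (x : EuclideanSpace ℝ (Fin (n+1))) : ℝ :=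
  auxD γ x i / auxd γ x - ((n:ℝ)+1)/2 * (x i / ‖x‖^2)

lemma contDiff_coord {n : ℕ} (i : Fin n) :
    ContDiff ℝ 1 (fun x : EuclideanSpace ℝ (Fin n) => x i) := by
  exact (EuclideanSpace.proj i : EuclideanSpace ℝ (Fin n) →L[ℝ] ℝ).contDiff

lemma contDiff_auxd {n : ℕ} (γ : ℝ) : ContDiff ℝ 1 (auxd (n := n) γ) := by
  unfold auxd
  exact (contDiff_coord _).sub (contDiff_const.mul
    (ContDiff.sum fun i _ => (contDiff_coord i.castSucc).pow 2))

lemma contDiff_auxD {n : ℕ} (γ : ℝ) (i : Fin (n+1)) : ContDiff ℝ 1 (fun x => auxD (n := n) γ x i) := by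
  unfold auxD
  split_ifs
  · exact contDiff_const
  · exact contDiff_const.mul (contDiff_coord _)

lemma contDiffAt_auxF {n : ℕ} (γ : ℝ) (i : Fin (n+1)) (x : EuclideanSpace ℝ (Fin (n+1)))
    (hd : auxd γ x ≠ 0) (hx : x ≠ 0) : ContDiffAt ℝ 1 (auxF γ i) x := by
  unfold auxF
  refine ((contDiff_auxD γ i).contDiffAt.div (contDiff_auxd γ).contDiffAt hd).sub
    (contDiffAt_const.mul ((contDiff_coord i).contDiffAt.div (contDiff_norm_sq ℝ).contDiffAt ?_))
  simpa using hx

/-- unit vectors -/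
noncomputable def auxe {n : ℕ} (i : Fin n) : EuclideanSpace ℝ (Fin n) := EuclideanSpace.single i 1

lemma hasD_coord {n : ℕ} (i j : Fin n) (x : EuclideanSpace ℝ (Fin n)) :
    HasLineDerivAt ℝ (fun x : EuclideanSpace ℝ (Fin n) => x j) (if j = i then 1 else 0) x (auxe i) := by
  have := ((EuclideanSpace.proj j : EuclideanSpace ℝ (Fin n) →L[ℝ] ℝ).hasFDerivAt (x := x)).hasLineDerivAt (auxe i)
  simpa [auxe] using this

lemma hasD_auxd {n : ℕ} (γ : ℝ) (i : Fin (n+1)) (x : EuclideanSpace ℝ (Fin (n+1))) :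
    HasLineDerivAt ℝ (auxd γ) (auxD γ x i) x (auxe i) := by
  unfold auxd
  have h := HasDerivAt.sub (hasD_coord i (Fin.last n) x) (HasDerivAt.const_mul γ
    (HasDerivAt.fun_sum (u := Finset.univ) fun (j : Fin n) _ => HasDerivAt.pow (hasD_coord i j.castSucc x) 2))
  refine HasDerivAt.congr_deriv h ?_
  unfold auxD
  refine Fin.lastCases ?_ (fun k => ?_) i
  · simp
  · simp [(Fin.castSucc_lt_last k).ne, (Fin.castSucc_lt_last k).ne']
    ring

lemma hasD_normsq {n : ℕ} (i : Fin n) (x : EuclideanSpace ℝ (Fin n)) :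
    HasLineDerivAt ℝ (fun x : EuclideanSpace ℝ (Fin n) => ‖x‖^2) (2 * x i) x (auxe i) := by
  have := (hasStrictFDerivAt_norm_sq x).hasFDerivAt.hasLineDerivAt (auxe i)
  simpa [auxe, EuclideanSpace.inner_single_right] using this

lemma hasD_auxD {n : ℕ} (γ : ℝ) (i : Fin (n+1)) (x : EuclideanSpace ℝ (Fin (n+1))) :
    HasLineDerivAt ℝ (fun x => auxD γ x i) (if i = Fin.last n then 0 else -2*γ) x (auxe i) := by
  unfold auxD
  split_ifs
  · exact hasDerivAt_const _ _
  · refine HasDerivAt.congr_deriv (HasDerivAt.const_mul (-2*γ) (hasD_coord i i x)) ?_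
    simp

noncomputable def auxG {n : ℕ} (γ : ℝ) (i : Fin (n+1)) (x : EuclideanSpace ℝ (Fin (n+1))) : ℝ :=
  (if i = Fin.last n then 0 else -2*γ) / auxd γ x - (auxD γ x i)^2 / (auxd γ x)^2
    - ((n:ℝ)+1)/2 * (1 / ‖x‖^2 - 2 * x i ^2 / ‖x‖^4)

lemma hasD_auxF {n : ℕ} (γ : ℝ) (i : Fin (n+1)) (x : EuclideanSpace ℝ (Fin (n+1)))
    (hd : auxd γ x ≠ 0) (hx : x ≠ 0) :
    HasLineDerivAt ℝ (auxF γ i) (auxG γ i x) x (auxe i) := by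
  unfold auxF
  have hx' : ‖x‖ ≠ 0 := by simpa using hx
  have h := HasDerivAt.sub (HasDerivAt.div (hasD_auxD γ i x) (hasD_auxd γ i x) (by simpa using hd))
    (HasDerivAt.const_mul (((n:ℝ)+1)/2)
      (HasDerivAt.div (hasD_coord i i x) (hasD_normsq i x) (by simpa using hx)))
  refine HasDerivAt.congr_deriv h ?_
  unfold auxG
  simp only [zero_smul, add_zero, if_true]
  field_simp

lemma aux_sum {n : ℕ} (γ : ℝ) (hγ : 0 < γ) (x : EuclideanSpace ℝ (Fin (n+1)))
    (hd : 0 < auxd γ x) (hx : x ≠ 0) :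
    ∑ i, (auxF γ i x ^ 2 + auxG γ i x) + (((n:ℝ)+1)^2/4 / ‖x‖^2
      + γ * (((n:ℝ)+1) - 2) / auxd γ x) ≤ 0 := by
  have hx' : 0 < ‖x‖^2 := by positivity
  have hr : ‖x‖^2 = ∑ i : Fin n, x i.castSucc ^ 2 + x (Fin.last n)^2 := by
    rw [EuclideanSpace.real_norm_sq_eq, Fin.sum_univ_castSucc]
  have h4 : ‖x‖^4 = (‖x‖^2)^2 := by ring
  have hdd : auxd γ x = x (Fin.last n) - γ * ∑ i : Fin n, x i.castSucc ^ 2 := rfl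
  have hterm : ∀ i, auxF γ i x ^ 2 + auxG γ i x =
      (if i = Fin.last n then 0 else -2*γ) / auxd γ x
      - ((n:ℝ)+1) / (auxd γ x * ‖x‖^2) * (auxD γ x i * x i)
      + (((n:ℝ)+1)^2/4 + ((n:ℝ)+1)) / (‖x‖^2)^2 * x i ^2 - ((n:ℝ)+1)/2 / ‖x‖^2 := by
    intro i
    unfold auxF auxG
    rw [h4]
    field_simp
    ring
  have hs1 : ∑ i : Fin (n+1), auxD γ x i * x i
      = x (Fin.last n) - 2 * γ * ∑ i : Fin n, x i.castSucc ^ 2 := by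
    rw [Fin.sum_univ_castSucc, Finset.mul_sum]
    simp only [auxD, if_true, (Fin.castSucc_lt_last _).ne, if_false, one_mul]
    rw [add_comm, sub_eq_add_neg, ← Finset.sum_neg_distrib]
    congr 1
    exact Finset.sum_congr rfl fun i _ => by ring
  have hs2 : ∑ i : Fin (n+1), ((if i = Fin.last n then 0 else -2*γ) : ℝ) = -2*γ*n := by
    rw [Fin.sum_univ_castSucc]
    simp [(Fin.castSucc_lt_last _).ne]
    ring
  have hs3 : ∑ i : Fin (n+1), x i ^ 2 = ‖x‖^2 := (EuclideanSpace.real_norm_sq_eq x).symm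
  simp_rw [hterm]
  rw [Finset.sum_sub_distrib, Finset.sum_add_distrib, Finset.sum_sub_distrib, ← Finset.sum_div,
    ← Finset.mul_sum, ← Finset.mul_sum, hs1, hs2, hs3]
  simp only [Finset.sum_const, Finset.card_univ, Fintype.card_fin, nsmul_eq_mul]
  set s := ∑ i : Fin n, x i.castSucc ^ 2
  set d := auxd γ x
  set L := x (Fin.last n)
  set R := ‖x‖^2
  have hL : L = d + γ * s := by linarith
  have : -2 * γ * n / d - ((n:ℝ) + 1) / (d * R) * (L - 2 * γ * s)
      + (((n:ℝ) + 1) ^ 2 / 4 + ((n:ℝ) + 1)) / R ^ 2 * R - ((n + 1 : ℕ) : ℝ) * (((n:ℝ) + 1) / 2 / R)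
      + (((n:ℝ) + 1) ^ 2 / 4 / R + γ * ((n:ℝ) + 1 - 2) / d)
      = - (γ * ((n:ℝ)+1) * (L^2) / (d * R)) := by
    rw [hL, show (d + γ*s)^2 = R - s by rw [← hL]; linarith]
    push_cast
    field_simp
    ring
  rw [this, neg_nonpos]
  positivity

lemma norm_grad {n : ℕ} (v : EuclideanSpace ℝ (Fin n) → ℝ) (x : EuclideanSpace ℝ (Fin n)) :
    ‖gradient v x‖^2 = ∑ i, (fderiv ℝ v x (auxe i))^2 := by
  rw [EuclideanSpace.real_norm_sq_eq]
  refine Finset.sum_congr rfl fun i _ => ?_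
  congr 1
  rw [← toDual_gradient, InnerProductSpace.toDual_apply_apply, auxe,
    EuclideanSpace.inner_single_right]
  simp

theorem main_aux (n : ℕ) (γ : ℝ) (hγ : 0 < γ)
    (Ω : Set (EuclideanSpace ℝ (Fin (n+1)))) 
    (hΩP : Ω ⊆ paraboloid (n+1) γ) (v : EuclideanSpace ℝ (Fin (n+1)) → ℝ)
    (hv : ContDiff ℝ (⊤ : ℕ∞) v) (hc : HasCompactSupport v) (hs : tsupport v ⊆ Ω) :
      (∫ x in Ω, ‖gradient v x‖ ^ 2) ≥
        (((n+1 : ℕ) : ℝ) ^ 2 / 4) * (∫ x in Ω, (v x) ^ 2 / ‖x‖ ^ 2)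
        + γ * (((n+1 : ℕ) : ℝ) - 2) * ∫ x in Ω, (v x) ^ 2 / (lastCoord x - γ * sqNormPrime x) := by
  have hv1 : ContDiff ℝ 1 v := hv.of_le (by exact_mod_cast le_top)
  have hdeq : ∀ x : EuclideanSpace ℝ (Fin (n+1)), lastCoord x - γ * sqNormPrime x = auxd γ x := by
    intro x; rw [aux_last, aux_prime]; rfl
  have hpos : ∀ x ∈ tsupport v, 0 < auxd γ x := by
    intro x hx
    have := hΩP (hs hx)
    rw [← hdeq]
    simpa [paraboloid] using this
  have hne : ∀ x ∈ tsupport v, x ≠ 0 := by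
    rintro x hx rfl
    have := hpos _ hx
    simp [auxd] at this
  simp_rw [hdeq]
  have hnot : ∀ x, x ∉ Ω → x ∉ tsupport v := fun x hx h => hx (hs h)
  have hgrad0 : ∀ x, x ∉ tsupport v → fderiv ℝ v x = 0 := by
    intro x hx
    by_contra h
    exact hx (support_fderiv_subset ℝ h)
  rw [setIntegral_eq_integral_of_forall_compl_eq_zero (fun x hx => by
      rw [norm_grad, hgrad0 x (hnot x hx)]; simp),
    setIntegral_eq_integral_of_forall_compl_eq_zero (fun x hx => by
      rw [image_eq_zero_of_notMem_tsupport (hnot x hx)]; simp),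
    setIntegral_eq_integral_of_forall_compl_eq_zero (fun x hx => by
      rw [image_eq_zero_of_notMem_tsupport (hnot x hx)]; simp)]
  -- the square of `v`
  have hu : ContDiff ℝ 1 (fun x => v x ^ 2) := hv1.pow 2
  have husub : tsupport (fun x => v x ^ 2) ⊆ tsupport v := by
    apply closure_mono
    intro x hx h
    exact hx (by simp [h])
  have huc : HasCompactSupport (fun x => v x ^ 2) := hc.of_isClosed_subset (isClosed_tsupport _) husub
  have hmulc : ∀ h : EuclideanSpace ℝ (Fin (n+1)) → ℝ,
      HasCompactSupport (fun x => v x ^ 2 * h x) := fun h => huc.mul_right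
  have hint : ∀ h : EuclideanSpace ℝ (Fin (n+1)) → ℝ, (∀ x ∈ tsupport v, ContDiffAt ℝ 1 h x) →
      Integrable (fun x => v x ^ 2 * h x) := fun h hh =>
    (aux_contDiff _ h hu (fun x hx => hh x (husub hx))).continuous.integrable_of_hasCompactSupport
      (hmulc h)
  have hI1 : Integrable (fun x => v x ^ 2 / ‖x‖^2) := by
    simp_rw [div_eq_mul_inv]
    refine hint _ fun x hx => (contDiff_norm_sq ℝ).contDiffAt.inv ?_
    simpa using hne x hx
  have hI2 : Integrable (fun x => v x ^ 2 / auxd γ x) := by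
    simp_rw [div_eq_mul_inv]
    exact hint _ fun x hx => (contDiff_auxd γ).contDiffAt.inv (hpos x hx).ne'
  have hg : ∀ i, ContDiff ℝ 1 (fun x => v x ^ 2 * auxF γ i x) := fun i =>
    aux_contDiff _ _ hu fun x hx =>
      contDiffAt_auxF γ i x (hpos x (husub hx)).ne' (hne x (husub hx))
  have hz := fun i => aux_int_zero _ (hg i) (hmulc _) (auxe i)
  have hI3 : Integrable (fun x => ‖gradient v x‖^2) := by
    simp_rw [norm_grad]
    refine integrable_finsetSum _ fun i _ => ?_
    apply Continuous.integrable_of_hasCompactSupport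
    · exact ((hv1.continuous_fderiv one_ne_zero).clm_apply continuous_const).pow 2
    · have := hc.fderiv_apply (𝕜 := ℝ) (auxe i)
      exact this.comp_left (g := fun t : ℝ => t^2) (by simp)
  have hzero : ∫ x, ∑ i, fderiv ℝ (fun x => v x ^ 2 * auxF γ i x) x (auxe i) = 0 := by
    rw [integral_finsetSum _ fun i _ => (hz i).1]
    exact Finset.sum_eq_zero fun i _ => (hz i).2
  have hI4 : Integrable (fun x => ∑ i, fderiv ℝ (fun x => v x ^ 2 * auxF γ i x) x (auxe i)) :=
    integrable_finsetSum _ fun i _ => (hz i).1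
  have key : ∀ x, ((n+1 : ℕ) : ℝ) ^ 2 / 4 * (v x ^ 2 / ‖x‖^2)
      + γ * (((n+1 : ℕ) : ℝ) - 2) * (v x ^ 2 / auxd γ x)
      + ∑ i, fderiv ℝ (fun x => v x ^ 2 * auxF γ i x) x (auxe i) ≤ ‖gradient v x‖^2 := by
    intro x
    rw [norm_grad]
    by_cases hx : x ∈ tsupport v
    · have hd := hpos x hx
      have hx0 := hne x hx
      have hder : ∀ i, fderiv ℝ (fun x => v x ^ 2 * auxF γ i x) x (auxe i)
          = 2 * v x * fderiv ℝ v x (auxe i) * auxF γ i x + v x ^ 2 * auxG γ i x := by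
        intro i
        have h1 := ((hg i).differentiable one_ne_zero x).hasFDerivAt.hasLineDerivAt (auxe i)
        have h2 := (hv1.differentiable one_ne_zero x).hasFDerivAt.hasLineDerivAt (auxe i)
        have h3 := HasDerivAt.mul (HasDerivAt.pow h2 2) (hasD_auxF γ i x hd.ne' hx0)
        have h4 := HasDerivAt.unique h1 h3
        rw [h4]
        simp
      have hsum := mul_le_mul_of_nonneg_left (aux_sum γ hγ x hd hx0) (sq_nonneg (v x))
      have hsq : 0 ≤ ∑ i, (fderiv ℝ v x (auxe i) - v x * auxF γ i x)^2 :=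
        Finset.sum_nonneg fun i _ => sq_nonneg _
      have hexp : ∑ i, (fderiv ℝ v x (auxe i) - v x * auxF γ i x)^2
          = ∑ i, (fderiv ℝ v x (auxe i))^2
            - ∑ i, (2 * v x * fderiv ℝ v x (auxe i) * auxF γ i x + v x ^ 2 * auxG γ i x)
            + v x ^ 2 * ∑ i, (auxF γ i x ^ 2 + auxG γ i x) := by
        rw [Finset.mul_sum, ← Finset.sum_sub_distrib, ← Finset.sum_add_distrib]
        exact Finset.sum_congr rfl fun i _ => by ring
      simp_rw [hder]
      push_cast
      have e1 : ((n:ℝ)+1)^2/4 * (v x ^ 2 / ‖x‖^2) + γ * ((n:ℝ)+1-2) * (v x ^ 2 / auxd γ x)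
        = v x ^ 2 * (((n:ℝ)+1)^2/4 / ‖x‖^2 + γ * (((n:ℝ)+1) - 2) / auxd γ x) := by ring
      rw [e1]
      rw [mul_add] at hsum
      linarith
    · have h0 : ∀ i, fderiv ℝ (fun x => v x ^ 2 * auxF γ i x) x (auxe i) = 0 := by
        intro i
        have : (fun x => v x ^ 2 * auxF γ i x) =ᶠ[nhds x] fun _ => 0 := by
          filter_upwards [notMem_tsupport_iff_eventuallyEq.mp hx] with y hy
          simp [hy]
        rw [this.fderiv_eq]
        simp
      simp_rw [h0]
      rw [image_eq_zero_of_notMem_tsupport hx, hgrad0 x hx]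
      simp
  have hA := hI1.const_mul (((n+1 : ℕ) : ℝ) ^ 2 / 4)
  have hB := hI2.const_mul (γ * (((n+1 : ℕ) : ℝ) - 2))
  have hfin := integral_mono ((hA.add hB).add hI4) hI3 key
  rw [integral_add' (hA.add hB) hI4, integral_add' hA hB, hzero, integral_const_mul, integral_const_mul] at hfin
  linarith

theorem stmt3 (N : ℕ) (hN : 2 ≤ N) (γ : ℝ) (hγ : 0 < γ)
    (Ω : Set (EuclideanSpace ℝ (Fin N))) (hΩo : IsOpen Ω)
    (hΩP : Ω ⊆ paraboloid N γ) :
    ∀ v : EuclideanSpace ℝ (Fin N) → ℝ,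
      ContDiff ℝ (⊤ : ℕ∞) v → HasCompactSupport v → tsupport v ⊆ Ω →
      (∫ x in Ω, ‖gradient v x‖ ^ 2) ≥
        ((N : ℝ) ^ 2 / 4) * (∫ x in Ω, (v x) ^ 2 / ‖x‖ ^ 2)
        + γ * ((N : ℝ) - 2) * ∫ x in Ω, (v x) ^ 2 / (lastCoord x - γ * sqNormPrime x) := by
  obtain ⟨n, rfl⟩ : ∃ n, N = n + 1 := ⟨N - 1, by omega⟩
  intro v hv hc hs
  exact main_aux n γ hγ Ω hΩP v hv hc hs
end

section
/- Let N ≥ 2 be an integer and let Ω ⊂ ℝ^N be a bounded open set contained in the half-space {x ∈ ℝ^N : x_N > 0}. Let L be a real number with L > sup_{x∈Ω} |x|. Then for every v ∈ C_c^∞(Ω): ∫_Ω |∇v(x)|² dx ≥ (N²/4) ∫_Ω v(x)²/|x|² dx + (1/4) ∫_Ω v(x)² / (|x|² (log(L/|x|))²) dx. -/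
open Real MeasureTheory

theorem cd_mul {N : ℕ} {Ω : Set (EuclideanSpace ℝ (Fin N))}
    {v H : EuclideanSpace ℝ (Fin N) → ℝ} (hv : ContDiff ℝ (⊤ : ℕ∞) v)
    (hs : tsupport v ⊆ Ω) (hH : ∀ x ∈ Ω, ContDiffAt ℝ 1 H x) :
    ContDiff ℝ 1 (fun x => v x ^ 2 * H x) := by
  rw [contDiff_iff_contDiffAt]
  intro x
  by_cases hx : x ∈ tsupport v
  · exact ((hv.contDiffAt.of_le (by exact_mod_cast le_top)).pow 2).mul (hH x (hs hx))
  · have h0 : (fun x => v x ^ 2 * H x) =ᶠ[nhds x] fun _ => 0 := by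
      filter_upwards [notMem_tsupport_iff_eventuallyEq.mp hx] with y hy
      simp [hy]
    exact contDiffAt_const.congr_of_eventuallyEq h0

theorem cs_mul {N : ℕ} {v H : EuclideanSpace ℝ (Fin N) → ℝ} (hc : HasCompactSupport v) :
    HasCompactSupport (fun x => v x ^ 2 * H x) := by
  refine hc.mono ?_
  intro x hx hv
  simp [hv] at hx

theorem int_div_zero {N : ℕ} {w : EuclideanSpace ℝ (Fin N) → ℝ} (hw : ContDiff ℝ 1 w)
    (hc : HasCompactSupport w) (e : EuclideanSpace ℝ (Fin N)) :
    Integrable (fun x => fderiv ℝ w x e) ∧ ∫ x, fderiv ℝ w x e = 0 := by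
  have hi : Integrable (fun x => fderiv ℝ w x e) := by
    refine Continuous.integrable_of_hasCompactSupport
      ((hw.continuous_fderiv (by simp)).clm_apply continuous_const) ?_
    exact hc.fderiv_apply (𝕜 := ℝ) e
  refine ⟨hi, ?_⟩
  have := integral_mul_fderiv_eq_neg_fderiv_mul_of_integrable (μ := volume) (v := e)
    (f := w) (g := fun _ => (1 : ℝ)) (by simpa using hi) (by simp)
    (by simpa using hw.continuous.integrable_of_hasCompactSupport hc)
    (fun x _ => hw.differentiable (by simp) x) (fun x _ => by fun_prop)
  simp at this
  linarith

noncomputable def GG (N : ℕ) (L s : ℝ) : ℝ := (-(N / 2) - 1 / (2 * (Real.log L - Real.log s / 2))) / s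

theorem GG_deriv (N : ℕ) (L s : ℝ) (hs : 0 < s) (hl : 0 < Real.log L - Real.log s / 2) :
    HasDerivAt (GG N L)
      (-1 / (4 * s ^ 2 * (Real.log L - Real.log s / 2) ^ 2) - GG N L s / s) s := by
  have h1 : HasDerivAt (fun s => 2 * (Real.log L - Real.log s / 2)) (2 * (0 - s⁻¹ / 2)) s :=
    (((hasDerivAt_const s (Real.log L)).sub ((Real.hasDerivAt_log hs.ne').div_const 2))).const_mul 2
  have h2 := (((hasDerivAt_const s (-((N : ℝ) / 2))).sub
    ((hasDerivAt_const s (1 : ℝ)).div h1 (by positivity))).div (hasDerivAt_id s) hs.ne')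
  refine (h2.congr_deriv ?_)
  simp only [GG, id]
  simp only [Pi.sub_apply, Pi.div_apply]
  clear h2 h1
  generalize Real.log L - Real.log s / 2 = l at *
  field_simp
  ring

theorem GG_smooth (N : ℕ) (L s : ℝ) (hs : 0 < s) (hl : 0 < Real.log L - Real.log s / 2) :
    ContDiffAt ℝ 1 (GG N L) s := by
  have h := (Real.contDiffAt_log (n := 1)).2 hs.ne'
  unfold GG
  refine ContDiffAt.div ?_ contDiffAt_id hs.ne'
  refine contDiffAt_const.sub (contDiffAt_const.div (contDiffAt_const.mul
    (contDiffAt_const.sub (h.div_const 2))) (by positivity))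

theorem grad_sq {N : ℕ} (v : EuclideanSpace ℝ (Fin N) → ℝ) (x : EuclideanSpace ℝ (Fin N)) :
    ‖gradient v x‖ ^ 2 = ∑ i, (fderiv ℝ v x (EuclideanSpace.single i 1)) ^ 2 := by
  rw [EuclideanSpace.real_norm_sq_eq]
  refine Finset.sum_congr rfl fun i _ => ?_
  congr 1
  have : inner ℝ (gradient v x) (EuclideanSpace.single i (1 : ℝ))
      = fderiv ℝ v x (EuclideanSpace.single i 1) := by
    simp [gradient]
  rw [← this, EuclideanSpace.inner_single_right]
  simp

/-- The components of the vector field `∇φ/φ`. -/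
noncomputable def FF {N : ℕ} (L : ℝ) (n i : Fin N) (x : EuclideanSpace ℝ (Fin N)) : ℝ :=
  (if i = n then 1 else 0) / x n + GG N L (‖x‖ ^ 2) * x i

theorem FF_smooth {N : ℕ} (L : ℝ) (n i : Fin N) (x : EuclideanSpace ℝ (Fin N)) (hn : 0 < x n)
    (hs : 0 < ‖x‖ ^ 2) (hl : 0 < Real.log L - Real.log (‖x‖ ^ 2) / 2) :
    ContDiffAt ℝ 1 (FF L n i) x := by
  have hc : ∀ j : Fin N, ContDiffAt ℝ 1 (fun x : EuclideanSpace ℝ (Fin N) => x j) x := fun j =>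
    (EuclideanSpace.proj (𝕜 := ℝ) j).contDiff.contDiffAt
  unfold FF
  refine (contDiffAt_const.div (hc n) hn.ne').add (ContDiffAt.mul ?_ (hc i))
  exact (GG_smooth N L _ hs hl).comp x (contDiff_norm_sq ℝ).contDiffAt

theorem FF_deriv {N : ℕ} (L : ℝ) (n i : Fin N) (x : EuclideanSpace ℝ (Fin N)) (hn : 0 < x n)
    (hs : 0 < ‖x‖ ^ 2) (hl : 0 < Real.log L - Real.log (‖x‖ ^ 2) / 2) :
    fderiv ℝ (FF L n i) x (EuclideanSpace.single i 1) =
      -(if i = n then 1 else 0) / (x n) ^ 2 + GG N L (‖x‖ ^ 2)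
      + 2 * (x i) ^ 2 * (-1 / (4 * (‖x‖ ^ 2) ^ 2 * (Real.log L - Real.log (‖x‖ ^ 2) / 2) ^ 2)
          - GG N L (‖x‖ ^ 2) / ‖x‖ ^ 2) := by
  have hp : ∀ j : Fin N, HasFDerivAt (fun x : EuclideanSpace ℝ (Fin N) => x j)
      (EuclideanSpace.proj (𝕜 := ℝ) j : EuclideanSpace ℝ (Fin N) →L[ℝ] ℝ) x := fun j =>
    (EuclideanSpace.proj (𝕜 := ℝ) j : EuclideanSpace ℝ (Fin N) →L[ℝ] ℝ).hasFDerivAt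
  have h1 := (hasDerivAt_inv hn.ne').comp_hasFDerivAt x (hp n)
  have h2 := (GG_deriv N L _ hs hl).comp_hasFDerivAt x (hasStrictFDerivAt_norm_sq x).hasFDerivAt
  have h3 := (h1.const_mul (if i = n then (1 : ℝ) else 0)).add (h2.mul (hp i))
  have h4 : HasFDerivAt (FF L n i) _ x := h3
  rw [h4.fderiv]
  by_cases h : i = n
  · subst h
    simp [EuclideanSpace.inner_single_right]
    ring
  · simp [EuclideanSpace.inner_single_right, h]
    ring

theorem lastCoord_eq {N : ℕ} (hN : 2 ≤ N) (x : EuclideanSpace ℝ (Fin N)) :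
    lastCoord x = x ⟨N - 1, by omega⟩ := by
  unfold lastCoord
  rw [Finset.sum_eq_single ⟨N - 1, by omega⟩]
  · rw [if_pos]; simp; omega
  · intro b _ hb
    rw [if_neg]
    intro h
    apply hb
    ext; simp; omega
  · simp

theorem pointwise {N : ℕ} (L : ℝ) (n : Fin N) (x : EuclideanSpace ℝ (Fin N)) (hn : 0 < x n)
    (hs : 0 < ‖x‖ ^ 2) (hl : 0 < Real.log L - Real.log (‖x‖ ^ 2) / 2)
    (v : EuclideanSpace ℝ (Fin N) → ℝ) (hv : ContDiff ℝ (⊤ : ℕ∞) v) :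
    (N : ℝ) ^ 2 / 4 * (v x ^ 2 * (1 / ‖x‖ ^ 2))
      + 1 / 4 * (v x ^ 2 * (1 / (‖x‖ ^ 2 * (Real.log L - Real.log (‖x‖ ^ 2) / 2) ^ 2)))
      + ∑ i, fderiv ℝ (fun x => v x ^ 2 * FF L n i x) x (EuclideanSpace.single i 1)
    ≤ ‖gradient v x‖ ^ 2 := by
  have hd : ∀ i, fderiv ℝ (fun x => v x ^ 2 * FF L n i x) x (EuclideanSpace.single i 1)
      = 2 * v x * fderiv ℝ v x (EuclideanSpace.single i 1) * FF L n i x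
        + v x ^ 2 * fderiv ℝ (FF L n i) x (EuclideanSpace.single i 1) := by
    intro i
    have h1 : HasFDerivAt v (fderiv ℝ v x) x := (hv.differentiable (by simp) x).hasFDerivAt
    have h2 := ((FF_smooth L n i x hn hs hl).differentiableAt (by simp)).hasFDerivAt
    have h3 : HasFDerivAt (fun x => v x ^ 2 * FF L n i x) _ x := (h1.pow 2).mul h2
    rw [h3.fderiv]
    simp
    ring
  have hsum : ∑ i, (x i) ^ 2 = ‖x‖ ^ 2 := (EuclideanSpace.real_norm_sq_eq x).symm
  have hF2 : ∑ i, (FF L n i x) ^ 2 = 1 / (x n) ^ 2 + 2 * GG N L (‖x‖ ^ 2)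
      + (GG N L (‖x‖ ^ 2)) ^ 2 * ‖x‖ ^ 2 := by
    have : ∀ i, (FF L n i x) ^ 2 = (if i = n then 1 / (x n) ^ 2 + 2 * GG N L (‖x‖ ^ 2) else 0)
        + (GG N L (‖x‖ ^ 2)) ^ 2 * (x i) ^ 2 := by
      intro i
      unfold FF
      split_ifs with h
      · subst h; field_simp; ring
      · ring
    simp_rw [this]
    rw [Finset.sum_add_distrib, ← Finset.mul_sum, hsum]
    simp
  have hdiv : ∑ i, fderiv ℝ (FF L n i) x (EuclideanSpace.single i 1) =
      -1 / (x n) ^ 2 + N * GG N L (‖x‖ ^ 2) + 2 * ‖x‖ ^ 2 *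
      (-1 / (4 * (‖x‖ ^ 2) ^ 2 * (Real.log L - Real.log (‖x‖ ^ 2) / 2) ^ 2)
          - GG N L (‖x‖ ^ 2) / ‖x‖ ^ 2) := by
    simp_rw [fun i => FF_deriv L n i x hn hs hl]
    rw [Finset.sum_add_distrib, Finset.sum_add_distrib, ← Finset.sum_mul, ← Finset.mul_sum, hsum,
      ← Finset.sum_div]
    simp
  have key : ‖gradient v x‖ ^ 2 - ∑ i, fderiv ℝ (fun x => v x ^ 2 * FF L n i x) x
        (EuclideanSpace.single i 1)
      = ∑ i, (fderiv ℝ v x (EuclideanSpace.single i 1) - v x * FF L n i x) ^ 2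
        - v x ^ 2 * ∑ i, (FF L n i x) ^ 2
        - v x ^ 2 * ∑ i, fderiv ℝ (FF L n i) x (EuclideanSpace.single i 1) := by
    rw [grad_sq, Finset.mul_sum, Finset.mul_sum, ← Finset.sum_sub_distrib,
      ← Finset.sum_sub_distrib, ← Finset.sum_sub_distrib]
    refine Finset.sum_congr rfl fun i _ => ?_
    rw [hd]
    ring
  have hnn : 0 ≤ ∑ i, (fderiv ℝ v x (EuclideanSpace.single i 1) - v x * FF L n i x) ^ 2 :=
    Finset.sum_nonneg fun i _ => sq_nonneg _
  have halg : (N : ℝ) ^ 2 / 4 * (v x ^ 2 * (1 / ‖x‖ ^ 2))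
      + 1 / 4 * (v x ^ 2 * (1 / (‖x‖ ^ 2 * (Real.log L - Real.log (‖x‖ ^ 2) / 2) ^ 2)))
      = - v x ^ 2 * ∑ i, (FF L n i x) ^ 2
        - v x ^ 2 * ∑ i, fderiv ℝ (FF L n i) x (EuclideanSpace.single i 1) := by
    rw [hF2, hdiv]
    unfold GG
    generalize Real.log L - Real.log (‖x‖ ^ 2) / 2 = l at *
    generalize ‖x‖ ^ 2 = s at *
    field_simp
    ring
  linarith

theorem stmt4 (N : ℕ) (hN : 2 ≤ N)
    (Ω : Set (EuclideanSpace ℝ (Fin N))) (hΩo : IsOpen Ω)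
    (hΩb : Bornology.IsBounded Ω)
    (hΩhalf : Ω ⊆ {x | 0 < lastCoord x})
    (L : ℝ) (hL : (⨆ x : Ω, ‖(x : EuclideanSpace ℝ (Fin N))‖) < L) :
    ∀ v : EuclideanSpace ℝ (Fin N) → ℝ,
      ContDiff ℝ (⊤ : ℕ∞) v → HasCompactSupport v → tsupport v ⊆ Ω →
      (∫ x in Ω, ‖gradient v x‖ ^ 2) ≥
        ((N : ℝ) ^ 2 / 4) * (∫ x in Ω, (v x) ^ 2 / ‖x‖ ^ 2)
        + (1 / 4) * ∫ x in Ω, (v x) ^ 2 / (‖x‖ ^ 2 * (Real.log (L / ‖x‖)) ^ 2) := by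
  intro v hv hc hs
  set n : Fin N := ⟨N - 1, by omega⟩ with hndef
  have hn : ∀ x ∈ Ω, 0 < x n := fun x hx => by
    have := hΩhalf hx
    simp only [Set.mem_ofPred_eq, lastCoord_eq hN] at this
    exact this
  have hpos : ∀ x ∈ Ω, 0 < ‖x‖ := fun x hx => by
    rw [norm_pos_iff]
    rintro rfl
    simpa using hn _ hx
  have hlt : ∀ x ∈ Ω, ‖x‖ < L := fun x hx => by
    refine lt_of_le_of_lt (le_ciSup (f := fun x : Ω => ‖(x : EuclideanSpace ℝ (Fin N))‖) ?_ ⟨x, hx⟩) hL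
    obtain ⟨C, hC⟩ := hΩb.exists_norm_le
    exact ⟨C, by rintro _ ⟨y, rfl⟩; exact hC _ y.2⟩
  have hlog : ∀ x ∈ Ω, Real.log (L / ‖x‖) = Real.log L - Real.log (‖x‖ ^ 2) / 2 := fun x hx => by
    rw [Real.log_div ((hpos x hx).trans (hlt x hx)).ne' (hpos x hx).ne', Real.log_pow]
    push_cast; ring
  have hl : ∀ x ∈ Ω, 0 < Real.log L - Real.log (‖x‖ ^ 2) / 2 := fun x hx => by
    rw [← hlog x hx]
    exact Real.log_pos ((one_lt_div (hpos x hx)).2 (hlt x hx))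
  have hs2 : ∀ x ∈ Ω, 0 < ‖x‖ ^ 2 := fun x hx => pow_pos (hpos x hx) 2
  have hnsq : ∀ x : EuclideanSpace ℝ (Fin N), ContDiffAt ℝ 1
      (fun x : EuclideanSpace ℝ (Fin N) => ‖x‖ ^ 2) x := fun x => (contDiff_norm_sq ℝ).contDiffAt
  have hA : Integrable (fun x => v x ^ 2 * (1 / ‖x‖ ^ 2)) :=
    (cd_mul hv hs fun x hx => contDiffAt_const.div (hnsq x)
      (hs2 x hx).ne').continuous.integrable_of_hasCompactSupport (cs_mul hc)
  have hB : Integrable (fun x => v x ^ 2 *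
      (1 / (‖x‖ ^ 2 * (Real.log L - Real.log (‖x‖ ^ 2) / 2) ^ 2))) := by
    refine (cd_mul hv hs fun x hx => contDiffAt_const.div ((hnsq x).mul
      ((contDiffAt_const.sub (((hnsq x).log (hs2 x hx).ne').div_const 2)).pow 2))
      ?_).continuous.integrable_of_hasCompactSupport (cs_mul hc)
    exact (mul_pos (hs2 x hx) (pow_pos (hl x hx) 2)).ne'
  have hD : ∀ i, _ := fun i => int_div_zero (cd_mul hv hs fun x hx =>
    FF_smooth L n i x (hn x hx) (hs2 x hx) (hl x hx)) (cs_mul hc) (EuclideanSpace.single i 1)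
  have hD0 : ∀ i, ∫ x in Ω, fderiv ℝ (fun x => v x ^ 2 * FF L n i x) x
      (EuclideanSpace.single i 1) = 0 := by
    intro i
    rw [setIntegral_eq_integral_of_forall_compl_eq_zero, (hD i).2]
    intro x hx
    have hx' : x ∉ tsupport v := fun h => hx (hs h)
    have h0 : (fun x => v x ^ 2 * FF L n i x) =ᶠ[nhds x] fun _ => 0 := by
      filter_upwards [notMem_tsupport_iff_eventuallyEq.mp hx'] with y hy
      simp [hy]
    rw [h0.fderiv_eq]
    simp
  have hG : Integrable (fun x => ‖gradient v x‖ ^ 2) := by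
    simp_rw [grad_sq]
    refine integrable_finset_sum _ fun i _ => ?_
    refine Continuous.integrable_of_hasCompactSupport
      (((hv.continuous_fderiv (by simp)).clm_apply continuous_const).pow 2) ?_
    refine (hc.fderiv_apply (𝕜 := ℝ) (EuclideanSpace.single i 1)).mono ?_
    intro x hx h
    apply hx
    simp only at h
    simp [h]
  have hI1 : ∫ x in Ω, (v x) ^ 2 / ‖x‖ ^ 2 = ∫ x in Ω, v x ^ 2 * (1 / ‖x‖ ^ 2) := by
    simp only [mul_one_div]
  have hI2 : ∫ x in Ω, (v x) ^ 2 / (‖x‖ ^ 2 * (Real.log (L / ‖x‖)) ^ 2) =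
      ∫ x in Ω, v x ^ 2 * (1 / (‖x‖ ^ 2 * (Real.log L - Real.log (‖x‖ ^ 2) / 2) ^ 2)) := by
    refine setIntegral_congr_fun hΩo.measurableSet fun x hx => ?_
    simp only [mul_one_div, hlog x hx]
  have hmono := setIntegral_mono_on (μ := volume) (s := Ω)
    (((hA.const_mul ((N : ℝ) ^ 2 / 4)).add (hB.const_mul (1 / 4))).add
      (integrable_finset_sum Finset.univ fun i _ => (hD i).1)).integrableOn hG.integrableOn
    hΩo.measurableSet
    (fun x hx => pointwise L n x (hn x hx) (hs2 x hx) (hl x hx) v hv)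
  rw [hI1, hI2, ge_iff_le]
  refine le_trans (le_of_eq ?_) hmono
  have e1 := integral_add (μ := volume.restrict Ω)
    ((hA.const_mul ((N : ℝ) ^ 2 / 4)).add (hB.const_mul (1 / 4))).integrableOn
    (integrable_finset_sum Finset.univ fun i _ => (hD i).1).integrableOn
  have e2 := integral_add (μ := volume.restrict Ω)
    (hA.const_mul ((N : ℝ) ^ 2 / 4)).integrableOn (hB.const_mul (1 / 4)).integrableOn
  have e3 := integral_finset_sum (μ := volume.restrict Ω) Finset.univ
    (fun i _ => (hD i).1.integrableOn)
  simp only [hD0, Finset.sum_const_zero] at e3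
  rw [integral_const_mul, integral_const_mul] at e2
  refine Eq.trans ?_ e1.symm
  rw [e3, add_zero]
  exact e2.symm
end

section
/- Let N ≥ 2 be an integer and let Ω ⊂ ℝ^N be a bounded open set such that there exist r > 0 and γ_loc ≥ 0 with Ω ∩ B(0,r) ⊆ P_{γ_loc} (i.e. Ω lies in the paraboloid P_{γ_loc} near the origin). Let L be a real number with L > sup_{x∈Ω} |x|. Then there exists a constant C ≥ 0 (depending on Ω, r, γ_loc and L) such that for every v ∈ C_c^∞(Ω): C ∫_Ω v(x)² dx + ∫_Ω |∇v(x)|² dx ≥ (N²/4) ∫_Ω v(x)²/|x|² dx + (1/4) ∫_Ω v(x)² / (|x|² (log(L/|x|))²) dx. -/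
open Real MeasureTheory

/-- Product of a compactly supported smooth function squared with a function smooth on `Ω`. -/
theorem contDiff_sq_mul_aux {N : ℕ} {Ω : Set (EuclideanSpace ℝ (Fin N))} (hΩ : IsOpen Ω)
    {v p : EuclideanSpace ℝ (Fin N) → ℝ} (hv : ContDiff ℝ 1 v) (hs : tsupport v ⊆ Ω)
    (hp : ∀ x ∈ Ω, ContDiffAt ℝ 1 p x) : ContDiff ℝ 1 (fun x => v x ^ 2 * p x) := by
  rw [contDiff_iff_contDiffAt]
  intro x
  by_cases hx : x ∈ Ω
  · exact (hv.contDiffAt.pow 2).mul (hp x hx)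
  · have hx' : x ∉ tsupport v := fun h => hx (hs h)
    have h0 : v =ᶠ[nhds x] 0 := notMem_tsupport_iff_eventuallyEq.mp hx'
    have : (fun x => v x ^ 2 * p x) =ᶠ[nhds x] fun _ => (0 : ℝ) := by
      filter_upwards [h0] with y hy
      simp [hy]
    exact contDiffAt_const.congr_of_eventuallyEq this

theorem hasCompactSupport_sq_mul_aux {N : ℕ}
    {v p : EuclideanSpace ℝ (Fin N) → ℝ} (hc : HasCompactSupport v) :
    HasCompactSupport (fun x => v x ^ 2 * p x) := by
  apply hc.mono
  intro x hx
  simp only [Function.mem_support, ne_eq] at hx ⊢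
  intro h
  apply hx
  simp [h]

theorem integrable_fderiv_aux {N : ℕ} {a : EuclideanSpace ℝ (Fin N) → ℝ}
    (ha : ContDiff ℝ 1 a) (hc : HasCompactSupport a) (e : EuclideanSpace ℝ (Fin N)) :
    Integrable (fun x => fderiv ℝ a x e) := by
  apply Continuous.integrable_of_hasCompactSupport
  · exact (ha.continuous_fderiv (by norm_num)).clm_apply continuous_const
  · exact hc.fderiv_apply ℝ e

theorem integral_fderiv_zero_aux {N : ℕ} {a : EuclideanSpace ℝ (Fin N) → ℝ}
    (ha : ContDiff ℝ 1 a) (hc : HasCompactSupport a) (e : EuclideanSpace ℝ (Fin N)) :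
    ∫ x, fderiv ℝ a x e = 0 := by
  have h := integral_mul_fderiv_eq_neg_fderiv_mul_of_integrable (μ := volume)
    (f := fun _ : EuclideanSpace ℝ (Fin N) => (1 : ℝ)) (g := a) (v := e)
    (by simp) (by simpa using integrable_fderiv_aux ha hc e)
    (by simpa using ha.continuous.integrable_of_hasCompactSupport hc)
    (fun x _ => by fun_prop) (fun x _ => ha.differentiable (by norm_num) x)
  simpa using h

theorem radial_aux {N : ℕ} {b : EuclideanSpace ℝ (Fin N) → ℝ}
    (hb : ContDiff ℝ 1 b) (hc : HasCompactSupport b) :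
    Integrable (fun x => (N : ℝ) * b x + fderiv ℝ b x x) ∧
    ∫ x, ((N : ℝ) * b x + fderiv ℝ b x x) = 0 := by
  have hcd : ∀ i : Fin N, ContDiff ℝ 1 (fun x : EuclideanSpace ℝ (Fin N) => b x * x i) :=
    fun i => hb.mul (by fun_prop)
  have hcs : ∀ i : Fin N, HasCompactSupport (fun x : EuclideanSpace ℝ (Fin N) => b x * x i) :=
    fun i => hc.mul_right
  have key : ∀ x : EuclideanSpace ℝ (Fin N), (N : ℝ) * b x + fderiv ℝ b x x =
      ∑ i : Fin N, fderiv ℝ (fun x : EuclideanSpace ℝ (Fin N) => b x * x i) x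
        (EuclideanSpace.single i (1 : ℝ)) := by
    intro x
    have h1 : ∀ i : Fin N, fderiv ℝ (fun x : EuclideanSpace ℝ (Fin N) => b x * x i) x
        (EuclideanSpace.single i (1 : ℝ)) =
        b x + x i * fderiv ℝ b x (EuclideanSpace.single i (1 : ℝ)) := by
      intro i
      have hp : HasFDerivAt (fun x : EuclideanSpace ℝ (Fin N) => x i)
          (EuclideanSpace.proj i : EuclideanSpace ℝ (Fin N) →L[ℝ] ℝ) x :=
        (EuclideanSpace.proj i : EuclideanSpace ℝ (Fin N) →L[ℝ] ℝ).hasFDerivAt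
      have := ((hb.differentiable (by norm_num) x).hasFDerivAt.mul hp).fderiv
      have h2 : fderiv ℝ (fun x : EuclideanSpace ℝ (Fin N) => b x * x i) x = _ := this
      rw [h2]
      simp
    simp_rw [h1]
    rw [Finset.sum_add_distrib]
    have h3 : x = ∑ i : Fin N, x i • EuclideanSpace.single i (1 : ℝ) := by
      ext j
      simp [Pi.single_apply]
    conv_lhs => rw [show fderiv ℝ b x x = fderiv ℝ b x (∑ i : Fin N, x i • EuclideanSpace.single i (1 : ℝ)) by rw [← h3]]
    simp
  simp_rw [key]
  constructor
  · exact integrable_finsetSum _ fun i _ => integrable_fderiv_aux (hcd i) (hcs i) _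
  · rw [integral_finsetSum _ fun i _ => integrable_fderiv_aux (hcd i) (hcs i) _]
    exact Finset.sum_eq_zero fun i _ => integral_fderiv_zero_aux (hcd i) (hcs i) _

/-- The cut-off as a function of `t = |x|²`. -/
noncomputable def cutG (r t : ℝ) : ℝ := Real.smoothTransition (2 - 4 * t / r ^ 2)

theorem cutG_contDiff (r : ℝ) : ContDiff ℝ 1 (cutG r) := by
  unfold cutG
  have h : ContDiff ℝ 1 Real.smoothTransition := Real.smoothTransition.contDiff (n := 1)
  exact h.comp (by fun_prop)

theorem cutG_zero {r t : ℝ} (hr : 0 < r) (ht : r ^ 2 / 2 ≤ t) : cutG r t = 0 := by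
  apply Real.smoothTransition.zero_of_nonpos
  have : 2 ≤ 4 * t / r ^ 2 := by
    rw [le_div_iff₀ (by positivity)]
    linarith
  linarith

theorem cutG_one {r t : ℝ} (hr : 0 < r) (ht : t ≤ r ^ 2 / 4) : cutG r t = 1 := by
  apply Real.smoothTransition.one_of_one_le
  have : 4 * t / r ^ 2 ≤ 1 := by
    rw [div_le_iff₀ (by positivity)]
    linarith
  linarith

/-- logarithm `log (L/|x|)` in terms of `t = |x|²`. -/
noncomputable def lamL (L t : ℝ) : ℝ := Real.log L - Real.log t / 2

noncomputable def kapL (n L t : ℝ) : ℝ := n / 2 + 1 / (2 * lamL L t)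

noncomputable def radH (n L r t : ℝ) : ℝ := cutG r t * kapL n L t / t

theorem radH_contDiffAt {n L r t : ℝ} (ht : t ≠ 0) (hl : lamL L t ≠ 0) :
    ContDiffAt ℝ 1 (radH n L r) t := by
  have h1 : ContDiffAt ℝ 1 (lamL L) t := by
    unfold lamL
    exact contDiffAt_const.sub ((Real.contDiffAt_log.2 ht).div_const 2)
  have h2 : ContDiffAt ℝ 1 (kapL n L) t := by
    unfold kapL
    exact contDiffAt_const.add (contDiffAt_const.div (contDiffAt_const.mul h1) (by simpa using hl))
  unfold radH
  exact ((cutG_contDiff r).contDiffAt.mul h2).div contDiffAt_id ht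

theorem radH_hasDerivAt {n L r t : ℝ} (ht : t ≠ 0) (hl : lamL L t ≠ 0) :
    HasDerivAt (radH n L r) ((deriv (cutG r) t * kapL n L t
      + cutG r t * (1 / (4 * t * lamL L t ^ 2))) / t - cutG r t * kapL n L t / t ^ 2) t := by
  have h1 : HasDerivAt (lamL L) (-(1 / (2 * t))) t := by
    have := ((Real.hasDerivAt_log ht).div_const 2).const_sub (Real.log L)
    refine this.congr_deriv ?_
    field_simp
  have h2 : HasDerivAt (kapL n L) (1 / (4 * t * lamL L t ^ 2)) t := by
    have := ((hasDerivAt_const t (1 : ℝ)).div (h1.const_mul 2) (by simpa using hl)).const_add (n / 2)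
    refine this.congr_deriv ?_
    field_simp
    ring
  have h3 : HasDerivAt (cutG r) (deriv (cutG r) t) t :=
    ((cutG_contDiff r).differentiable (by norm_num) t).hasDerivAt
  have := (h3.mul h2).div (hasDerivAt_id t) ht
  refine this.congr_deriv ?_
  simp only [id, Pi.mul_apply]
  field_simp

/-- The scalar inequality behind the theorem. -/
theorem scalar_aux (n t y g g' k l v A B G2 C1 C2 : ℝ) (ht : 0 < t) (hyt : y ^ 2 ≤ t)
    (hl : l ≠ 0) (hk : k = n / 2 + 1 / (2 * l)) (hg0 : 0 ≤ g) (hg1 : g ≤ 1)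
    (hy : g = 0 ∨ y ≠ 0)
    (hsq : 0 ≤ G2 + 2 * v * ((-g / y) * A + (g * k / t) * B)
      + v ^ 2 * ((-g / y) ^ 2 + 2 * (-g / y) * (g * k / t) * y + (g * k / t) ^ 2 * t))
    (hC1 : |2 * g' * (k - 1)| ≤ C1)
    (hC2 : (1 - g) * (n ^ 2 / 4 / t + 1 / 4 / (t * l ^ 2)) ≤ C2) :
    v ^ 2 * (n ^ 2 / 4 / t + 1 / 4 / (t * l ^ 2)) ≤
      (C1 + C2) * v ^ 2 + G2 + ((2 * v * A * (-g / y) + v ^ 2 * (-2 * g' + g / y ^ 2))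
        + (n * (v ^ 2 * (g * k / t)) + (2 * v * B * (g * k / t)
          + v ^ 2 * (2 * t * ((g' * k + g * (1 / (4 * t * l ^ 2))) / t - g * k / t ^ 2))))) := by
  have hdiv : n ^ 2 / 4 / t + 1 / 4 / (t * l ^ 2) - (C1 + C2) ≤
      (-2 * g' + g / y ^ 2) + n * (g * k / t) + 2 * t * ((g' * k + g * (1 / (4 * t * l ^ 2))) / t - g * k / t ^ 2)
       - ((-g / y) ^ 2 + 2 * (-g / y) * (g * k / t) * y + (g * k / t) ^ 2 * t) := by
    have hC1' := (abs_le.1 hC1).1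
    rcases hy with rfl | hy
    · have : (2 : ℝ) * t * ((g' * k + 0 * (1 / (4 * t * l ^ 2))) / t - 0 * k / t ^ 2) = 2 * g' * k := by
        field_simp
        ring
      rw [this]
      simp
      simp at hC2
      nlinarith
    · have hid : (-2 * g' + g / y ^ 2) + n * (g * k / t) + 2 * t * ((g' * k + g * (1 / (4 * t * l ^ 2))) / t - g * k / t ^ 2)
       - ((-g / y) ^ 2 + 2 * (-g / y) * (g * k / t) * y + (g * k / t) ^ 2 * t)
        = (n ^ 2 / 4 / t + 1 / 4 / (t * l ^ 2)) - (1 - g) * (n ^ 2 / 4 / t + 1 / 4 / (t * l ^ 2))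
          + g * (1 - g) * ((1 / y ^ 2 - 1 / t) + (k - 1) ^ 2 / t) + 2 * g' * (k - 1) := by
        rw [hk]
        field_simp
        ring
      rw [hid]
      have h1 : 0 ≤ 1 / y ^ 2 - 1 / t := by
        have : 1 / t ≤ 1 / y ^ 2 := one_div_le_one_div_of_le (by positivity) hyt
        linarith
      have h2 : 0 ≤ g * (1 - g) * ((1 / y ^ 2 - 1 / t) + (k - 1) ^ 2 / t) := by
        have : 0 ≤ 1 - g := by linarith
        positivity
      linarith
  have := mul_le_mul_of_nonneg_left hdiv (sq_nonneg v)
  nlinarith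

theorem sqNormPrime_nonneg {N : ℕ} (x : EuclideanSpace ℝ (Fin N)) : 0 ≤ sqNormPrime x := by
  unfold sqNormPrime
  apply Finset.sum_nonneg
  intro i _
  split_ifs <;> positivity

set_option maxHeartbeats 1600000 in
theorem stmt6 (N : ℕ) (hN : 2 ≤ N)
    (Ω : Set (EuclideanSpace ℝ (Fin N))) (hΩo : IsOpen Ω)
    (hΩb : Bornology.IsBounded Ω)
    (r : ℝ) (hr : 0 < r) (γloc : ℝ) (hγloc : 0 ≤ γloc)
    (hloc : Ω ∩ Metric.ball 0 r ⊆ paraboloid N γloc)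
    (L : ℝ) (hL : (⨆ x : Ω, ‖(x : EuclideanSpace ℝ (Fin N))‖) < L) :
    ∃ C ≥ (0 : ℝ), ∀ v : EuclideanSpace ℝ (Fin N) → ℝ,
      ContDiff ℝ (⊤ : ℕ∞) v → HasCompactSupport v → tsupport v ⊆ Ω →
      C * (∫ x in Ω, (v x) ^ 2) + (∫ x in Ω, ‖gradient v x‖ ^ 2) ≥
        ((N : ℝ) ^ 2 / 4) * (∫ x in Ω, (v x) ^ 2 / ‖x‖ ^ 2)
        + (1 / 4) * ∫ x in Ω, (v x) ^ 2 / (‖x‖ ^ 2 * (Real.log (L / ‖x‖)) ^ 2) := by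
  set S : ℝ := ⨆ x : Ω, ‖(x : EuclideanSpace ℝ (Fin N))‖ with hS
  have hS0 : 0 ≤ S := Real.iSup_nonneg fun x => norm_nonneg _
  have hL0 : 0 < L := by linarith
  have hSle : ∀ x ∈ Ω, ‖x‖ ≤ S := by
    intro x hx
    obtain ⟨R, hR⟩ := hΩb.exists_norm_le
    exact le_ciSup (f := fun x : Ω => ‖(x : EuclideanSpace ℝ (Fin N))‖)
      ⟨R, by rintro _ ⟨y, rfl⟩; exact hR y y.2⟩ ⟨x, hx⟩
  set i₀ : Fin N := ⟨N - 1, by omega⟩ with hi₀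
  have hpos : ∀ x ∈ Ω, ‖x‖ < r → 0 < x i₀ := by
    intro x hx hxr
    have h1 : x ∈ paraboloid N γloc := hloc ⟨hx, by simpa using hxr⟩
    have h2 : γloc * sqNormPrime x < lastCoord x := h1
    rw [lastCoord_eq hN] at h2
    have := mul_nonneg hγloc (sqNormPrime_nonneg x)
    linarith
  have hne : ∀ x ∈ Ω, x ≠ 0 := by
    rintro x hx rfl
    have := hpos 0 hx (by simpa using hr)
    simp at this
  have hxpos : ∀ x ∈ Ω, 0 < ‖x‖ := fun x hx => norm_pos_iff.2 (hne x hx)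
  set m : ℝ := Real.log (L / ((S + L) / 2)) with hm
  have hm0 : 0 < m := by
    apply Real.log_pos
    rw [one_lt_div (by linarith)]
    linarith
  have hlam : ∀ x ∈ Ω, lamL L (‖x‖ ^ 2) = Real.log (L / ‖x‖) := by
    intro x hx
    unfold lamL
    rw [Real.log_div hL0.ne' (hxpos x hx).ne', Real.log_pow]
    push_cast
    ring
  have hlm : ∀ x ∈ Ω, m ≤ lamL L (‖x‖ ^ 2) := by
    intro x hx
    rw [hlam x hx]
    apply Real.log_le_log
    · positivity
    · apply div_le_div_of_nonneg_left hL0.le (hxpos x hx)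
      have := hSle x hx
      linarith
  have hlne : ∀ x ∈ Ω, lamL L (‖x‖ ^ 2) ≠ 0 := fun x hx => (hm0.trans_le (hlm x hx)).ne'
  obtain ⟨M, hM⟩ := (isCompact_Icc (a := (0 : ℝ)) (b := L ^ 2)).exists_bound_of_continuousOn
    ((cutG_contDiff r).continuous_deriv (by norm_num)).continuousOn
  have hM0 : 0 ≤ M := (norm_nonneg _).trans (hM 0 ⟨le_rfl, by positivity⟩)
  set C1 : ℝ := 2 * M * (N / 2 + 1 / (2 * m) + 1) with hC1
  set C2 : ℝ := ((N : ℝ) ^ 2 / 4 + 1 / 4 / m ^ 2) / (r ^ 2 / 4) with hC2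
  have hC10 : 0 ≤ C1 := by positivity
  have hC20 : 0 ≤ C2 := by positivity
  refine ⟨C1 + C2, by positivity, ?_⟩
  intro v hv hvc hvs
  have hv1 : ContDiff ℝ 1 v := hv.of_le (by exact_mod_cast le_top)
  set e : EuclideanSpace ℝ (Fin N) := EuclideanSpace.single i₀ (1 : ℝ) with he
  set p : EuclideanSpace ℝ (Fin N) → ℝ := fun x => -cutG r (‖x‖ ^ 2) / x i₀ with hp
  set q : EuclideanSpace ℝ (Fin N) → ℝ := fun x => radH N L r (‖x‖ ^ 2) with hq
  have hns : ∀ x : EuclideanSpace ℝ (Fin N), HasFDerivAt (fun x : EuclideanSpace ℝ (Fin N) => ‖x‖ ^ 2)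
      (2 • innerSL ℝ x) x := fun x => (hasStrictFDerivAt_norm_sq x).hasFDerivAt
  have hnsc : ContDiff ℝ 1 (fun x : EuclideanSpace ℝ (Fin N) => ‖x‖ ^ 2) := contDiff_norm_sq ℝ
  have hqc : ∀ x ∈ Ω, ContDiffAt ℝ 1 q x := fun x hx =>
    ContDiffAt.comp x (radH_contDiffAt (pow_pos (hxpos x hx) 2).ne' (hlne x hx)) hnsc.contDiffAt
  have hqd : ∀ x ∈ Ω, fderiv ℝ q x x = 2 * ‖x‖ ^ 2 * ((deriv (cutG r) (‖x‖ ^ 2) * kapL N L (‖x‖ ^ 2)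
      + cutG r (‖x‖ ^ 2) * (1 / (4 * ‖x‖ ^ 2 * lamL L (‖x‖ ^ 2) ^ 2))) / ‖x‖ ^ 2
        - cutG r (‖x‖ ^ 2) * kapL N L (‖x‖ ^ 2) / (‖x‖ ^ 2) ^ 2) := by
    intro x hx
    have h1 := (radH_hasDerivAt (n := N) (r := r) (pow_pos (hxpos x hx) 2).ne'
      (hlne x hx)).comp_hasFDerivAt x (hns x)
    have h2 : fderiv ℝ q x = _ := h1.fderiv
    rw [h2]
    simp only [_root_.smul_apply, innerSL_apply_apply, real_inner_self_eq_norm_sq,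
      smul_eq_mul, nsmul_eq_mul]
    push_cast
    ring
  have hpd : ∀ x ∈ Ω, ContDiffAt ℝ 1 p x ∧ fderiv ℝ p x e =
      -2 * deriv (cutG r) (‖x‖ ^ 2) + cutG r (‖x‖ ^ 2) / (x i₀) ^ 2 := by
    intro x hx
    by_cases hxr : ‖x‖ < r
    · have hy := hpos x hx hxr
      have hproj : HasFDerivAt (fun x : EuclideanSpace ℝ (Fin N) => x i₀)
          (EuclideanSpace.proj i₀ : EuclideanSpace ℝ (Fin N) →L[ℝ] ℝ) x :=
        (EuclideanSpace.proj i₀ : EuclideanSpace ℝ (Fin N) →L[ℝ] ℝ).hasFDerivAt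
      have hprojc : ContDiff ℝ 1 (fun x : EuclideanSpace ℝ (Fin N) => x i₀) := by fun_prop
      constructor
      · exact ContDiffAt.div (((cutG_contDiff r).comp hnsc).neg.contDiffAt) hprojc.contDiffAt hy.ne'
      · have hline : HasLineDerivAt ℝ p
            (-2 * deriv (cutG r) (‖x‖ ^ 2) + cutG r (‖x‖ ^ 2) / (x i₀) ^ 2) x e := by
          have h3 : HasDerivAt (cutG r) (deriv (cutG r) (‖x‖ ^ 2)) (‖x‖ ^ 2) :=
            ((cutG_contDiff r).differentiable (by norm_num) _).hasDerivAt
          have h4 := (h3.comp_hasFDerivAt x (hns x)).hasLineDerivAt e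
          have h5 := hproj.hasLineDerivAt e
          unfold HasLineDerivAt at h4 h5 ⊢
          have h6 := h4.neg.div h5 (by simpa using hy.ne')
          refine h6.congr_deriv ?_
          simp [he, EuclideanSpace.inner_single_right]
          field_simp
        have hdiff : DifferentiableAt ℝ p x :=
          (ContDiffAt.div (((cutG_contDiff r).comp hnsc).neg.contDiffAt) hprojc.contDiffAt
            hy.ne' : ContDiffAt ℝ 1 p x).differentiableAt (by norm_num)
        rw [← hdiff.lineDeriv_eq_fderiv]
        exact hline.lineDeriv
    · push Not at hxr
      have hbig : r ^ 2 / 2 < ‖x‖ ^ 2 := by nlinarith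
      have hp0 : p =ᶠ[nhds x] fun _ => (0 : ℝ) := by
        have : ∀ᶠ y in nhds x, r ^ 2 / 2 < ‖y‖ ^ 2 :=
          hnsc.continuous.continuousAt.eventually (lt_mem_nhds hbig)
        filter_upwards [this] with y hy
        simp [hp, cutG_zero hr hy.le]
      refine ⟨contDiffAt_const.congr_of_eventuallyEq hp0, ?_⟩
      have hg0 : cutG r =ᶠ[nhds (‖x‖ ^ 2)] fun _ => (0 : ℝ) := by
        filter_upwards [lt_mem_nhds hbig] with y hy
        exact cutG_zero hr hy.le
      rw [hp0.fderiv_eq, hg0.deriv_eq, cutG_zero hr hbig.le]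
      simp
  have hpc : ∀ x ∈ Ω, ContDiffAt ℝ 1 p x := fun x hx => (hpd x hx).1
  set a : EuclideanSpace ℝ (Fin N) → ℝ := fun x => v x ^ 2 * p x with ha
  set b : EuclideanSpace ℝ (Fin N) → ℝ := fun x => v x ^ 2 * q x with hb
  have hac : ContDiff ℝ 1 a := contDiff_sq_mul_aux hΩo hv1 hvs hpc
  have hbc : ContDiff ℝ 1 b := contDiff_sq_mul_aux hΩo hv1 hvs hqc
  have has : HasCompactSupport a := hasCompactSupport_sq_mul_aux hvc
  have hbs : HasCompactSupport b := hasCompactSupport_sq_mul_aux hvc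
  set D : EuclideanSpace ℝ (Fin N) → ℝ :=
    fun x => fderiv ℝ a x e + ((N : ℝ) * b x + fderiv ℝ b x x) with hD
  have hDint : Integrable D := (integrable_fderiv_aux hac has e).add (radial_aux hbc hbs).1
  have hD0 : ∫ x, D x = 0 := by
    rw [hD, integral_add (integrable_fderiv_aux hac has e) (radial_aux hbc hbs).1,
      integral_fderiv_zero_aux hac has e, (radial_aux hbc hbs).2, add_zero]
  have hDΩ : ∫ x in Ω, D x = 0 := by
    rw [setIntegral_eq_integral_of_forall_compl_eq_zero, hD0]
    intro x hx
    have hx' : x ∉ tsupport v := fun h => hx (hvs h)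
    have h0 : v =ᶠ[nhds x] 0 := notMem_tsupport_iff_eventuallyEq.mp hx'
    have ha0 : a =ᶠ[nhds x] fun _ => (0 : ℝ) := by
      filter_upwards [h0] with y hy
      simp [ha, hy]
    have hb0 : b =ᶠ[nhds x] fun _ => (0 : ℝ) := by
      filter_upwards [h0] with y hy
      simp [hb, hy]
    simp only [hD]
    rw [ha0.fderiv_eq, hb0.fderiv_eq, hb0.eq_of_nhds]
    simp
  have hInt : ∀ w : EuclideanSpace ℝ (Fin N) → ℝ, (∀ x ∈ Ω, ContDiffAt ℝ 1 w x) →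
      IntegrableOn (fun x => v x ^ 2 * w x) Ω := fun w hw =>
    ((contDiff_sq_mul_aux hΩo hv1 hvs hw).continuous.integrable_of_hasCompactSupport
      (hasCompactSupport_sq_mul_aux hvc)).integrableOn
  have hI0 : IntegrableOn (fun x => v x ^ 2) Ω := by
    simpa using hInt (fun _ => 1) (fun x _ => contDiffAt_const)
  have hI1 : IntegrableOn (fun x => v x ^ 2 / ‖x‖ ^ 2) Ω := by
    have := hInt (fun x => 1 / ‖x‖ ^ 2) (fun x hx =>
      contDiffAt_const.div hnsc.contDiffAt (pow_pos (hxpos x hx) 2).ne')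
    simpa [div_eq_mul_inv] using this
  have hI2 : IntegrableOn (fun x => v x ^ 2 / (‖x‖ ^ 2 * (Real.log (L / ‖x‖)) ^ 2)) Ω := by
    have := hInt (fun x => 1 / (‖x‖ ^ 2 * (Real.log (L / ‖x‖)) ^ 2)) (fun x hx => by
      have h1 : ContDiffAt ℝ 1 (fun x : EuclideanSpace ℝ (Fin N) => ‖x‖) x :=
        contDiffAt_norm ℝ (hne x hx)
      have h2 := hxpos x hx
      have h3 : ContDiffAt ℝ 1 (fun x : EuclideanSpace ℝ (Fin N) => Real.log (L / ‖x‖)) x :=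
        (contDiffAt_const.div h1 h2.ne').log (div_pos hL0 h2).ne'
      have h4 := hlne x hx
      rw [hlam x hx] at h4
      exact contDiffAt_const.div (hnsc.contDiffAt.mul (h3.pow 2))
        (mul_ne_zero (pow_ne_zero 2 h2.ne') (pow_ne_zero 2 h4)))
    simpa [div_eq_mul_inv] using this
  have hgrad : ∀ x, gradient v x = (InnerProductSpace.toDual ℝ _).symm (fderiv ℝ v x) :=
    fun x => rfl
  have hI3 : IntegrableOn (fun x => ‖gradient v x‖ ^ 2) Ω := by
    apply Integrable.integrableOn
    simp_rw [hgrad, LinearIsometryEquiv.norm_map]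
    apply Continuous.integrable_of_hasCompactSupport
    · exact (hv1.continuous_fderiv (by norm_num)).norm.pow 2
    · apply (hvc.fderiv ℝ).mono
      intro x hx
      simp only [Function.mem_support, ne_eq] at hx ⊢
      intro h
      apply hx
      simp [h]
  have hpt : ∀ x ∈ Ω, (N : ℝ) ^ 2 / 4 * (v x ^ 2 / ‖x‖ ^ 2)
      + 1 / 4 * (v x ^ 2 / (‖x‖ ^ 2 * (Real.log (L / ‖x‖)) ^ 2)) ≤
      (C1 + C2) * v x ^ 2 + ‖gradient v x‖ ^ 2 + D x := by
    intro x hx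
    have hvd : HasFDerivAt v (fderiv ℝ v x) x := (hv1.differentiable (by norm_num) x).hasFDerivAt
    have hgen : ∀ w : EuclideanSpace ℝ (Fin N) → ℝ, ContDiffAt ℝ 1 w x → ∀ z,
        fderiv ℝ (fun x => v x ^ 2 * w x) x z
          = 2 * v x * fderiv ℝ v x z * w x + v x ^ 2 * fderiv ℝ w x z := by
      intro w hw z
      have h1 := (hvd.pow 2).mul (hw.differentiableAt (by norm_num)).hasFDerivAt
      have h2 : fderiv ℝ (fun x => v x ^ 2 * w x) x = _ := h1.fderiv
      rw [h2]
      simp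
      ring
    have hbnd : ‖x‖ ≤ S := hSle x hx
    have hx0 := hxpos x hx
    have hl0 : 0 < lamL L (‖x‖ ^ 2) := hm0.trans_le (hlm x hx)
    have hg0 : 0 ≤ cutG r (‖x‖ ^ 2) := Real.smoothTransition.nonneg _
    have hg1 : cutG r (‖x‖ ^ 2) ≤ 1 := Real.smoothTransition.le_one _
    have hDx : D x = ((2 * v x * fderiv ℝ v x e * (-cutG r (‖x‖ ^ 2) / x i₀) + v x ^ 2 *
        (-2 * deriv (cutG r) (‖x‖ ^ 2) + cutG r (‖x‖ ^ 2) / x i₀ ^ 2))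
        + ((N : ℝ) * (v x ^ 2 * (cutG r (‖x‖ ^ 2) * kapL N L (‖x‖ ^ 2) / ‖x‖ ^ 2))
          + (2 * v x * fderiv ℝ v x x * (cutG r (‖x‖ ^ 2) * kapL N L (‖x‖ ^ 2) / ‖x‖ ^ 2)
          + v x ^ 2 * (2 * ‖x‖ ^ 2 * ((deriv (cutG r) (‖x‖ ^ 2) * kapL N L (‖x‖ ^ 2)
      + cutG r (‖x‖ ^ 2) * (1 / (4 * ‖x‖ ^ 2 * lamL L (‖x‖ ^ 2) ^ 2))) / ‖x‖ ^ 2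
        - cutG r (‖x‖ ^ 2) * kapL N L (‖x‖ ^ 2) / (‖x‖ ^ 2) ^ 2))))) := by
      simp only [hD]
      rw [ha, hb, hgen p (hpc x hx) e, hgen q (hqc x hx) x, hqd x hx, (hpd x hx).2]
      rfl
    have hyt : x i₀ ^ 2 ≤ ‖x‖ ^ 2 := by
      rw [EuclideanSpace.norm_sq_eq]
      have := Finset.single_le_sum (f := fun i => ‖x i‖ ^ 2) (fun i _ => sq_nonneg _)
        (Finset.mem_univ i₀)
      simpa using this
    have hk1 : |kapL N L (‖x‖ ^ 2) - 1| ≤ N / 2 + 1 / (2 * m) + 1 := by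
      have h1 : 1 / (2 * lamL L (‖x‖ ^ 2)) ≤ 1 / (2 * m) :=
        one_div_le_one_div_of_le (by positivity) (by linarith [hlm x hx])
      have h2 : 0 ≤ 1 / (2 * lamL L (‖x‖ ^ 2)) := by positivity
      have h3 : (0 : ℝ) ≤ N / 2 := by positivity
      unfold kapL
      rw [abs_le]
      constructor <;> linarith
    have hsc := scalar_aux (N : ℝ) (‖x‖ ^ 2) (x i₀) (cutG r (‖x‖ ^ 2)) (deriv (cutG r) (‖x‖ ^ 2))
      (kapL N L (‖x‖ ^ 2)) (lamL L (‖x‖ ^ 2)) (v x) (fderiv ℝ v x e) (fderiv ℝ v x x)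
      (‖gradient v x‖ ^ 2) C1 C2 (by positivity) hyt hl0.ne' rfl hg0 hg1
      (by
        by_cases hxr : ‖x‖ < r
        · exact Or.inr (hpos x hx hxr).ne'
        · left
          push Not at hxr
          exact cutG_zero hr (by nlinarith))
      (by
        have h1 := sq_nonneg ‖gradient v x + v x • ((p x) • e + (q x) • x)‖
        have hpx : p x = -cutG r (‖x‖ ^ 2) / x i₀ := rfl
        have hqx : q x = cutG r (‖x‖ ^ 2) * kapL N L (‖x‖ ^ 2) / ‖x‖ ^ 2 := rfl
        rw [← hpx, ← hqx]
        have hee : inner ℝ e e = (1 : ℝ) := by simp [he]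
        have hex : inner ℝ e x = x i₀ := by simp [he, EuclideanSpace.inner_single_left]
        have hge : inner ℝ (gradient v x) e = fderiv ℝ v x e := by
          rw [hgrad, InnerProductSpace.toDual_symm_apply]
        have hgx : inner ℝ (gradient v x) x = fderiv ℝ v x x := by
          rw [hgrad, InnerProductSpace.toDual_symm_apply]
        have hexp : ‖gradient v x + v x • ((p x) • e + (q x) • x)‖ ^ 2 =
          ‖gradient v x‖ ^ 2 + 2 * v x * (p x * fderiv ℝ v x e + q x * fderiv ℝ v x x) +
          v x ^ 2 * (p x ^ 2 + 2 * p x * q x * x i₀ + q x ^ 2 * ‖x‖ ^ 2) := by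
          rw [norm_add_sq_real, norm_smul, mul_pow, norm_add_sq_real, inner_smul_right,
            inner_add_right, inner_smul_right, inner_smul_right, inner_smul_right,
            real_inner_smul_left, norm_smul, norm_smul, hex, hge, hgx, mul_pow, mul_pow,
            ← real_inner_self_eq_norm_sq e, hee]
          simp only [Real.norm_eq_abs, sq_abs]
          ring
        rw [hexp] at h1
        exact h1)
      (by
        rw [abs_mul, abs_mul, abs_two]
        have h1 := hM (‖x‖ ^ 2) ⟨by positivity, by
          have : ‖x‖ ≤ L := by linarith
          gcongr⟩
        rw [Real.norm_eq_abs] at h1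
        rw [hC1]
        gcongr)
      (by
        by_cases hsm : ‖x‖ ^ 2 ≤ r ^ 2 / 4
        · rw [cutG_one hr hsm]
          simpa using hC20
        · push Not at hsm
          have h1 : (N : ℝ) ^ 2 / 4 / ‖x‖ ^ 2 + 1 / 4 / (‖x‖ ^ 2 * lamL L (‖x‖ ^ 2) ^ 2) ≤ C2 := by
            have : (N : ℝ) ^ 2 / 4 / ‖x‖ ^ 2 + 1 / 4 / (‖x‖ ^ 2 * lamL L (‖x‖ ^ 2) ^ 2)
              = ((N : ℝ) ^ 2 / 4 + 1 / 4 / (lamL L (‖x‖ ^ 2) ^ 2)) / ‖x‖ ^ 2 := by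
              field_simp
            rw [this, hC2]
            have := hlm x hx
            gcongr
          have h2 : 0 ≤ (N : ℝ) ^ 2 / 4 / ‖x‖ ^ 2 + 1 / 4 / (‖x‖ ^ 2 * lamL L (‖x‖ ^ 2) ^ 2) := by
            positivity
          exact (mul_le_of_le_one_left h2 (by linarith)).trans h1)
    rw [← hDx, hlam x hx] at hsc
    refine le_trans (le_of_eq ?_) hsc
    ring
  have hfin := setIntegral_mono_on ((hI1.const_mul ((N : ℝ) ^ 2 / 4)).add (hI2.const_mul (1 / 4)))
    (((hI0.const_mul (C1 + C2)).add hI3).add hDint.integrableOn) hΩo.measurableSet hpt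
  have hL1 := integral_add (hI1.const_mul ((N : ℝ) ^ 2 / 4)) (hI2.const_mul (1 / 4))
  have hR1 := integral_add ((hI0.const_mul (C1 + C2)).add hI3) hDint.integrableOn
  have hR2 := integral_add (hI0.const_mul (C1 + C2)) hI3
  simp only [Pi.add_apply] at hfin hL1 hR1 hR2
  rw [hL1, hR1, hR2, hDΩ, integral_const_mul, integral_const_mul, integral_const_mul] at hfin
  linarith
end

section
/- Let N ≥ 2 be an integer and let Ω ⊂ ℝ^N be a bounded open set such that there exist γ < 0 and r > 0 with Ω ∩ B(0,r) ⊆ P_γ (the hyperbolic case: near the origin Ω lies in a paraboloid opening below the hyperplane {x_N = 0}). Then for every ε with 0 < ε < N²/4 there exists a constant C ≥ 0 (depending on Ω, γ, r and ε) such that for every v ∈ C_c^∞(Ω): C ∫_Ω v(x)² dx + ∫_Ω |∇v(x)|² dx ≥ (N²/4 − ε) ∫_Ω v(x)²/|x|² dx. -/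
open Real MeasureTheory

set_option maxHeartbeats 2000000 in
lemma hardy_abstract {N : ℕ} (Ω : Set (EuclideanSpace ℝ (Fin N)))
    (h0 : (0 : EuclideanSpace ℝ (Fin N)) ∉ Ω)
    (G : Fin N → EuclideanSpace ℝ (Fin N) → ℝ)
    (hG : ∀ i, ∀ x ∈ Ω, ContDiffAt ℝ 1 (G i) x) (H C : ℝ)
    (hb : ∀ x ∈ Ω, ∑ i, fderiv ℝ (G i) x (EuclideanSpace.single i 1) - ∑ i, (G i x) ^ 2
      ≥ H / ‖x‖ ^ 2 - C)
    (v : EuclideanSpace ℝ (Fin N) → ℝ)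
    (hv : ContDiff ℝ (⊤ : ℕ∞) v) (hc : HasCompactSupport v) (hs : tsupport v ⊆ Ω) :
    C * (∫ x in Ω, (v x) ^ 2) + (∫ x in Ω, ‖gradient v x‖ ^ 2) ≥
          H * ∫ x in Ω, (v x) ^ 2 / ‖x‖ ^ 2 := by
  have hv1 : ContDiff ℝ 1 v := hv.of_le (by exact_mod_cast le_top)
  have hgrad : ∀ x, ‖gradient v x‖ ^ 2 = ∑ i, (fderiv ℝ v x (EuclideanSpace.single i 1)) ^ 2 := by
    intro x
    rw [EuclideanSpace.norm_sq_eq]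
    refine Finset.sum_congr rfl fun i _ => ?_
    have : fderiv ℝ v x (EuclideanSpace.single i 1) = gradient v x i := by
      have h := InnerProductSpace.toDual_symm_apply (𝕜 := ℝ) (x := EuclideanSpace.single i (1:ℝ))
        (y := fderiv ℝ v x)
      rw [← h, EuclideanSpace.inner_single_right]
      simp [gradient]
    rw [this, Real.norm_eq_abs, sq_abs]
  have hvz : ∀ x, x ∉ tsupport v → v =ᶠ[nhds x] 0 := fun x hx =>
    notMem_tsupport_iff_eventuallyEq.1 hx
  have hfz : ∀ x, x ∉ tsupport v → fderiv ℝ v x = 0 := fun x hx => by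
    rw [(hvz x hx).fderiv_eq]; simp
  -- the fields
  have hw : ∀ i, ContDiff ℝ 1 (fun x => (v x) ^ 2 * G i x) := by
    intro i
    rw [contDiff_iff_contDiffAt]
    intro x
    by_cases hx : x ∈ tsupport v
    · exact (hv1.contDiffAt.pow 2).mul (hG i x (hs hx))
    · refine (contDiffAt_const (c := (0:ℝ))).congr_of_eventuallyEq ?_
      filter_upwards [hvz x hx] with y hy
      simp [hy]
  have hwc : ∀ i, HasCompactSupport (fun x => (v x) ^ 2 * G i x) := by
    intro i
    refine hc.mono ?_
    intro x hx
    simp only [Function.mem_support] at *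
    intro h; simp [h] at hx
  have hwd : ∀ i, Continuous (fun x => fderiv ℝ (fun x => (v x) ^ 2 * G i x) x
      (EuclideanSpace.single i 1)) := fun i =>
    ((hw i).continuous_fderiv (by norm_num)).clm_apply continuous_const
  have hwdi : ∀ i, Integrable (fun x => fderiv ℝ (fun x => (v x) ^ 2 * G i x) x
      (EuclideanSpace.single i 1)) := fun i =>
    (hwd i).integrable_of_hasCompactSupport ((hwc i).fderiv_apply ℝ _)
  have hw0 : ∀ i, ∫ x, fderiv ℝ (fun x => (v x) ^ 2 * G i x) x
      (EuclideanSpace.single i 1) = 0 := by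
    intro i
    have := integral_mul_fderiv_eq_neg_fderiv_mul_of_integrable (μ := volume)
      (f := fun _ : EuclideanSpace ℝ (Fin N) => (1:ℝ)) (g := fun x => (v x) ^ 2 * G i x)
      (v := EuclideanSpace.single i 1) (by simp) (by simpa using hwdi i)
      (by simpa using (hw i).continuous.integrable_of_hasCompactSupport (hwc i))
      (fun x _ => differentiableAt_const _)
      (fun x _ => (hw i).differentiable (by norm_num) x)
    simpa using this
  have i1 : Integrable (fun x => (v x) ^ 2) :=
    Continuous.integrable_of_hasCompactSupport (f := fun x => (v x) ^ 2) (hv1.continuous.pow 2)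
      (hc.comp_left (g := fun y : ℝ => y ^ 2) (by simp))
  have i2 : Integrable (fun x => ‖gradient v x‖ ^ 2) := by
    simp_rw [hgrad]
    refine integrable_finsetSum _ fun i _ => ?_
    refine Continuous.integrable_of_hasCompactSupport
      (((hv1.continuous_fderiv (by norm_num)).clm_apply continuous_const).pow 2) ?_
    exact (hc.fderiv_apply ℝ (EuclideanSpace.single i 1)).comp_left (g := fun y => y ^ 2) (by simp)
  have i3 : Integrable (fun x => (v x) ^ 2 / ‖x‖ ^ 2) := by
    refine Continuous.integrable_of_hasCompactSupport ?_ ?_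
    · rw [continuous_iff_continuousAt]
      intro x
      by_cases hx : x ∈ tsupport v
      · have : x ≠ 0 := fun h => h0 (h ▸ hs hx)
        exact (hv1.continuous.pow 2).continuousAt.div (by fun_prop) (by simpa using this)
      · refine (continuousAt_const (y := (0:ℝ))).congr ?_
        filter_upwards [hvz x hx] with y hy
        simp [hy]
    · refine hc.mono ?_
      intro x hx
      simp only [Function.mem_support] at *
      intro h; simp [h] at hx
  have e1 : ∫ x in Ω, (v x) ^ 2 = ∫ x, (v x) ^ 2 :=
    setIntegral_eq_integral_of_forall_compl_eq_zero fun x hx => by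
      simp [image_eq_zero_of_notMem_tsupport (fun h => hx (hs h))]
  have e2 : ∫ x in Ω, ‖gradient v x‖ ^ 2 = ∫ x, ‖gradient v x‖ ^ 2 :=
    setIntegral_eq_integral_of_forall_compl_eq_zero fun x hx => by
      rw [hgrad]; simp [hfz x (fun h => hx (hs h))]
  have e3 : ∫ x in Ω, (v x) ^ 2 / ‖x‖ ^ 2 = ∫ x, (v x) ^ 2 / ‖x‖ ^ 2 :=
    setIntegral_eq_integral_of_forall_compl_eq_zero fun x hx => by
      simp [image_eq_zero_of_notMem_tsupport (fun h => hx (hs h))]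
  rw [e1, e2, e3]
  have i4 : Integrable (fun x => ∑ i, fderiv ℝ (fun x => (v x) ^ 2 * G i x) x
      (EuclideanSpace.single i 1)) := integrable_finsetSum _ fun i _ => hwdi i
  have e4 : ∫ x, ∑ i, fderiv ℝ (fun x => (v x) ^ 2 * G i x) x
      (EuclideanSpace.single i 1) = 0 := by
    rw [integral_finsetSum _ fun i _ => hwdi i]
    exact Finset.sum_eq_zero fun i _ => hw0 i
  have key : ∀ x, H * ((v x) ^ 2 / ‖x‖ ^ 2) ≤ C * (v x) ^ 2 + ‖gradient v x‖ ^ 2 +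
      ∑ i, fderiv ℝ (fun x => (v x) ^ 2 * G i x) x (EuclideanSpace.single i 1) := by
    intro x
    rw [hgrad]
    by_cases hx : x ∈ tsupport v
    · have hd : ∀ i, fderiv ℝ (fun x => (v x) ^ 2 * G i x) x (EuclideanSpace.single i 1) =
          2 * v x * fderiv ℝ v x (EuclideanSpace.single i 1) * G i x +
          (v x) ^ 2 * fderiv ℝ (G i) x (EuclideanSpace.single i 1) := by
        intro i
        have a1 := (hv1.differentiable (by norm_num) x).hasFDerivAt
        have a2 := ((hG i x (hs hx)).differentiableAt (by norm_num)).hasFDerivAt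
        have a3 : HasFDerivAt (fun x => (v x) ^ 2 * G i x) _ x := (a1.pow 2).mul a2
        rw [a3.fderiv]
        simp
        ring
      simp_rw [hd]
      have hB := mul_le_mul_of_nonneg_left (hb x (hs hx)) (sq_nonneg (v x))
      have hS : 0 ≤ ∑ i, (fderiv ℝ v x (EuclideanSpace.single i 1) + v x * G i x) ^ 2 :=
        Finset.sum_nonneg fun i _ => sq_nonneg _
      have hE : ∑ i, (fderiv ℝ v x (EuclideanSpace.single i 1) + v x * G i x) ^ 2 =
          ∑ i, (fderiv ℝ v x (EuclideanSpace.single i 1)) ^ 2 +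
          ∑ i, 2 * v x * fderiv ℝ v x (EuclideanSpace.single i 1) * G i x +
          (v x) ^ 2 * ∑ i, (G i x) ^ 2 := by
        rw [Finset.mul_sum, ← Finset.sum_add_distrib, ← Finset.sum_add_distrib]
        exact Finset.sum_congr rfl fun i _ => by ring
      rw [Finset.sum_add_distrib, ← Finset.mul_sum]
      have : H * ((v x) ^ 2 / ‖x‖ ^ 2) = (v x) ^ 2 * (H / ‖x‖ ^ 2) := by ring
      rw [this]
      linarith
    · have hd : ∀ i, fderiv ℝ (fun x => (v x) ^ 2 * G i x) x = 0 := by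
        intro i
        have : (fun x => (v x) ^ 2 * G i x) =ᶠ[nhds x] fun _ => 0 := by
          filter_upwards [hvz x hx] with y hy
          simp [hy]
        rw [this.fderiv_eq]; simp
      simp [hd, hfz x hx, image_eq_zero_of_notMem_tsupport hx]
  have i5 : Integrable (fun x => C * (v x) ^ 2 + ‖gradient v x‖ ^ 2) := (i1.const_mul C).add i2
  have := integral_mono (i3.const_mul H) (i5.add i4) key
  have e5 : ∫ x, (C * (v x) ^ 2 + ‖gradient v x‖ ^ 2 +
      ∑ i, fderiv ℝ (fun x => (v x) ^ 2 * G i x) x (EuclideanSpace.single i 1)) =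
      C * (∫ x, (v x) ^ 2) + ∫ x, ‖gradient v x‖ ^ 2 := by
    rw [integral_add i5 i4, integral_add (i1.const_mul C) i2, e4, integral_const_mul, add_zero]
  rw [integral_const_mul] at this
  have h6 := this.trans_eq e5
  linarith

noncomputable def Pf {N : ℕ} (η κ : ℝ) (l : Fin N) (x : EuclideanSpace ℝ (Fin N)) : ℝ :=
  x l * ‖x‖ + η * ‖x‖ ^ 2 - κ * (x l) ^ 2

noncomputable def dl {N : ℕ} (l i : Fin N) : ℝ := if i = l then 1 else 0

noncomputable def Df {N : ℕ} (η κ : ℝ) (l i : Fin N) (x : EuclideanSpace ℝ (Fin N)) : ℝ :=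
  dl l i * ‖x‖ + x l * x i / ‖x‖ + 2 * η * x i - 2 * κ * x l * dl l i

noncomputable def D2f {N : ℕ} (η κ : ℝ) (l i : Fin N) (x : EuclideanSpace ℝ (Fin N)) : ℝ :=
  2 * (dl l i * x i / ‖x‖) + x l * (1 / ‖x‖ - (x i) ^ 2 / ‖x‖ ^ 3) + 2 * η - 2 * κ * dl l i

noncomputable def Ff {N : ℕ} (η κ m : ℝ) (l i : Fin N) (x : EuclideanSpace ℝ (Fin N)) : ℝ :=
  m * x i / ‖x‖ ^ 2 - Df η κ l i x / Pf η κ l x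

lemma dl_sq {N : ℕ} (l i : Fin N) : dl l i * dl l i = dl l i := by
  unfold dl; split_ifs <;> simp

lemma Ff_contDiffAt {N : ℕ} (η κ m : ℝ) (l i : Fin N) (x : EuclideanSpace ℝ (Fin N))
    (hx : x ≠ 0) (hP : Pf η κ l x ≠ 0) : ContDiffAt ℝ 1 (Ff η κ m l i) x := by
  have hn : ContDiffAt ℝ 1 (fun x : EuclideanSpace ℝ (Fin N) => ‖x‖) x := contDiffAt_norm ℝ hx
  have hc : ∀ j, ContDiffAt ℝ 1 (fun x : EuclideanSpace ℝ (Fin N) => x j) x := fun j => by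
    fun_prop
  have hx' : ‖x‖ ≠ 0 := by simpa using hx
  have hP1 : ContDiffAt ℝ 1 (Pf η κ l) x := by
    unfold Pf
    exact (((hc l).mul hn).add (contDiffAt_const.mul (hn.pow 2))).sub
      (contDiffAt_const.mul ((hc l).pow 2))
  have hD1 : ContDiffAt ℝ 1 (Df η κ l i) x := by
    unfold Df
    exact (((contDiffAt_const.mul hn).add (((hc l).mul (hc i)).div hn hx')).add
      (contDiffAt_const.mul (hc i))).sub ((contDiffAt_const.mul (hc l)).mul contDiffAt_const)
  unfold Ff
  exact ((contDiffAt_const.mul (hc i)).div (hn.pow 2) (by positivity)).sub (hD1.div hP1 hP)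

lemma Ff_fderiv {N : ℕ} (η κ m : ℝ) (l i : Fin N) (x : EuclideanSpace ℝ (Fin N))
    (hx : x ≠ 0) (hP : Pf η κ l x ≠ 0) :
    fderiv ℝ (Ff η κ m l i) x (EuclideanSpace.single i 1) =
      m * (1 / ‖x‖ ^ 2 - 2 * (x i) ^ 2 / ‖x‖ ^ 4) - (D2f η κ l i x / Pf η κ l x -
        (Df η κ l i x) ^ 2 / (Pf η κ l x) ^ 2) := by
  rw [← ((Ff_contDiffAt η κ m l i x hx hP).differentiableAt (by norm_num)).lineDeriv_eq_fderiv]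
  refine HasLineDerivAt.lineDeriv ?_
  have hx' : ‖x‖ ≠ 0 := by simpa using hx
  have hnf : HasFDerivAt (fun y : EuclideanSpace ℝ (Fin N) => ‖y‖)
      (fderiv ℝ (fun y : EuclideanSpace ℝ (Fin N) => ‖y‖) x) x :=
    ((contDiffAt_norm ℝ hx).differentiableAt (n := 1) (by norm_num)).hasFDerivAt
  have hn : HasLineDerivAt ℝ (fun y : EuclideanSpace ℝ (Fin N) => ‖y‖) (x i / ‖x‖) x
      (EuclideanSpace.single i 1) := by
    have h1 := hnf.hasLineDerivAt (EuclideanSpace.single i (1:ℝ))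
    have h2 := ((hasStrictFDerivAt_norm_sq x).hasFDerivAt).hasLineDerivAt
      (EuclideanSpace.single i (1:ℝ))
    unfold HasLineDerivAt at h1 h2 ⊢
    have h3 := h1.pow 2
    have := h2.unique h3
    simp [EuclideanSpace.inner_single_right] at this
    convert h1 using 1
    rw [div_eq_iff hx']
    linarith
  have hc : ∀ j, HasLineDerivAt ℝ (fun y : EuclideanSpace ℝ (Fin N) => y j) (dl i j) x
      (EuclideanSpace.single i 1) := by
    intro j
    have := (EuclideanSpace.proj j : EuclideanSpace ℝ (Fin N) →L[ℝ] ℝ).hasFDerivAt (x := x)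
    have := this.hasLineDerivAt (EuclideanSpace.single i (1:ℝ))
    have h2 : (EuclideanSpace.proj j : EuclideanSpace ℝ (Fin N) →L[ℝ] ℝ)
        (EuclideanSpace.single i (1:ℝ)) = dl i j := by
      simp [dl, Pi.single_apply]
    rw [h2] at this
    exact this
  have hl := hc l
  have hi := hc i
  have hil : dl i l = dl l i := by unfold dl; simp [eq_comm]
  have hii : dl i i = 1 := by simp [dl]
  rw [hil] at hl
  rw [hii] at hi
  unfold HasLineDerivAt at *
  have hPd : HasDerivAt (fun t : ℝ => Pf η κ l (x + t • EuclideanSpace.single i (1:ℝ)))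
      (Df η κ l i x) 0 := by
    unfold Pf
    have := ((hl.mul hn).add ((hn.pow 2).const_mul η)).sub ((hl.pow 2).const_mul κ)
    refine HasDerivAt.congr_deriv this ?_
    simp [Df]
    field_simp
  have hDd : HasDerivAt (fun t : ℝ => Df η κ l i (x + t • EuclideanSpace.single i (1:ℝ)))
      (D2f η κ l i x) 0 := by
    unfold Df
    have := (((hn.const_mul (dl l i)).add ((hl.mul hi).div hn (by simpa using hx))).add
      (hi.const_mul (2 * η))).sub ((hl.const_mul (2 * κ)).mul_const (dl l i))
    refine HasDerivAt.congr_deriv this ?_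
    simp [D2f]
    have hh := dl_sq l i
    field_simp
    linear_combination (-2 * κ * ‖x‖ ^ 3) * hh
  unfold Ff
  have := ((hi.const_mul m).div (hn.pow 2) (by simpa using hx)).sub
    (hDd.div hPd (by simpa using hP))
  refine HasDerivAt.congr_deriv this ?_
  simp
  field_simp

lemma Ff_div {N : ℕ} (η κ : ℝ) (l : Fin N) (x : EuclideanSpace ℝ (Fin N))
    (hx : x ≠ 0) (hP : Pf η κ l x ≠ 0) :
    ∑ i, fderiv ℝ (Ff η κ (1 + (N:ℝ) / 2) l i) x (EuclideanSpace.single i 1)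
      - ∑ i, (Ff η κ (1 + (N:ℝ) / 2) l i x) ^ 2 =
      (1 + (N:ℝ) / 2) ^ 2 / ‖x‖ ^ 2 -
        ((N + 1) * (x l / ‖x‖) + 2 * η * N - 2 * κ) / Pf η κ l x := by
  have hx' : ‖x‖ ≠ 0 := by simpa using hx
  have hq : ∑ i, (x i) ^ 2 = ‖x‖ ^ 2 := by
    rw [EuclideanSpace.norm_sq_eq]; simp
  have hd1 : ∑ i, dl l i = 1 := by simp [dl]
  have hd2 : ∑ i, dl l i * x i = x l := by simp [dl]
  have hD2 : ∑ i, D2f η κ l i x = (N + 1) * (x l / ‖x‖) + 2 * η * N - 2 * κ := by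
    have : ∀ i, D2f η κ l i x = (2 / ‖x‖) * (dl l i * x i) + (x l / ‖x‖ + 2 * η)
        - x l / ‖x‖ ^ 3 * (x i) ^ 2 - 2 * κ * dl l i := by
      intro i; unfold D2f; ring
    simp_rw [this, Finset.sum_sub_distrib, Finset.sum_add_distrib, ← Finset.mul_sum, hq, hd1, hd2]
    simp
    field_simp
    ring
  have hD : ∑ i, x i * Df η κ l i x = 2 * Pf η κ l x := by
    have : ∀ i, x i * Df η κ l i x = (‖x‖ - 2 * κ * x l) * (dl l i * x i)
        + (x l / ‖x‖ + 2 * η) * (x i) ^ 2 := by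
      intro i; unfold Df; ring
    simp_rw [this, Finset.sum_add_distrib, ← Finset.mul_sum, hq, hd2]
    unfold Pf
    field_simp
    ring
  set m : ℝ := 1 + (N:ℝ) / 2 with hm
  rw [← hD2, ← Finset.sum_sub_distrib]
  have : ∀ i, fderiv ℝ (Ff η κ m l i) x (EuclideanSpace.single i 1) - (Ff η κ m l i x) ^ 2 =
      m / ‖x‖ ^ 2 - (2 * m + m ^ 2) / ‖x‖ ^ 4 * (x i) ^ 2 - 1 / Pf η κ l x * D2f η κ l i x +
      2 * m / (‖x‖ ^ 2 * Pf η κ l x) * (x i * Df η κ l i x) := by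
    intro i
    rw [Ff_fderiv η κ m l i x hx hP]
    unfold Ff
    field_simp
    ring
  simp_rw [this, Finset.sum_add_distrib, Finset.sum_sub_distrib, ← Finset.mul_sum, hq, hD]
  simp
  have hN : (N:ℝ) = 2 * m - 2 := by rw [hm]; ring
  rw [hN]
  field_simp
  ring

lemma Pf_pos {N : ℕ} (ε : ℝ) (hε : 0 < ε) (hN : 2 ≤ N) (l : Fin N) (η : ℝ)
    (hη : η = ε / (N * (N + 1 + ε)))
    (x : EuclideanSpace ℝ (Fin N)) (hx : x ≠ 0) (hs : -(η / 2) * ‖x‖ ≤ x l) :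
    0 < Pf η (N * η) l x := by
  have hN' : (2:ℝ) ≤ N := by exact_mod_cast hN
  have hr : 0 < ‖x‖ := by simpa using hx
  have hη0 : 0 < η := by rw [hη]; positivity
  have hη1 : N * η * (N + 1 + ε) = ε := by rw [hη]; field_simp
  have hη2 : N * η < 1 := by
    by_contra h
    push Not at h
    nlinarith
  have hle : |x l| ≤ ‖x‖ := by simpa using PiLp.norm_apply_le x l
  obtain ⟨h1, h2⟩ := abs_le.1 hle
  unfold Pf
  rcases le_total 0 (x l) with h | h
  · have : x l ^ 2 ≤ x l * ‖x‖ := by nlinarith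
    have : N * η * x l ^ 2 ≤ x l ^ 2 := by nlinarith [sq_nonneg (x l)]
    have : 0 < η * ‖x‖ ^ 2 := by positivity
    linarith
  · have a1 : x l * ‖x‖ ≥ -(η / 2) * ‖x‖ ^ 2 := by nlinarith
    have a2 : N * η * x l ^ 2 ≤ x l ^ 2 := by nlinarith [sq_nonneg (x l)]
    have a3 : x l ^ 2 ≤ (η / 2) * ‖x‖ * ‖x‖ * (η / 2) := by nlinarith
    have a4 : η < 1 := by nlinarith
    have : 0 < η * ‖x‖ ^ 2 := by positivity
    nlinarith

lemma Pf_key {N : ℕ} (ε : ℝ) (hε : 0 < ε) (hN : 2 ≤ N) (l : Fin N) (η : ℝ)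
    (hη : η = ε / (N * (N + 1 + ε)))
    (x : EuclideanSpace ℝ (Fin N)) (hx : x ≠ 0) (hs : -(η / 2) * ‖x‖ ≤ x l) :
    (1 + (N:ℝ) / 2) ^ 2 / ‖x‖ ^ 2 -
        ((N + 1) * (x l / ‖x‖) + 2 * η * N - 2 * (N * η)) / Pf η (N * η) l x ≥
      ((N:ℝ) ^ 2 / 4 - ε) / ‖x‖ ^ 2 := by
  have hP := Pf_pos ε hε hN l η hη x hx hs
  have hN' : (2:ℝ) ≤ N := by exact_mod_cast hN
  have hr : 0 < ‖x‖ := by simpa using hx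
  have hη0 : 0 < η := by rw [hη]; positivity
  have hη1 : N * η * (N + 1 + ε) = ε := by rw [hη]; field_simp
  have hη2 : N * η < 1 := by
    by_contra h
    push Not at h
    nlinarith
  have a4 : η < 1 := by nlinarith
  have hle : |x l| ≤ ‖x‖ := by simpa using PiLp.norm_apply_le x l
  obtain ⟨h1, h2⟩ := abs_le.1 hle
  have main : (N + 1) * (x l * ‖x‖) ≤ (N + 1 + ε) * Pf η (N * η) l x := by
    have e : (N + 1 + ε) * Pf η (N * η) l x = (N + 1 + ε) * (x l * ‖x‖)
        + (N + 1 + ε) * (η * ‖x‖ ^ 2) - ε * x l ^ 2 := by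
      unfold Pf
      linear_combination (-(x l) ^ 2) * hη1
    rw [e]
    rcases le_total 0 (x l) with h | h
    · have b1 : x l ^ 2 ≤ x l * ‖x‖ := by nlinarith
      have b2 : 0 ≤ (N + 1 + ε) * (η * ‖x‖ ^ 2) := by positivity
      nlinarith
    · have a1 : x l * ‖x‖ ≥ -(η / 2) * ‖x‖ ^ 2 := by nlinarith
      have a3 : x l ^ 2 ≤ (η / 2) * ‖x‖ * ‖x‖ * (η / 2) := by nlinarith
      have a5 : x l ^ 2 ≤ (η / 2) * ‖x‖ ^ 2 := by
        have : 0 ≤ η / 2 * ‖x‖ ^ 2 := by positivity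
        nlinarith
      have a6 : 0 ≤ (N + 1) * (η * ‖x‖ ^ 2) := by positivity
      nlinarith
  have h3 : ((N + 1) * (x l / ‖x‖) + 2 * η * N - 2 * (N * η)) / Pf η (N * η) l x ≤
      (N + 1 + ε) / ‖x‖ ^ 2 := by
    rw [div_le_div_iff₀ hP (by positivity)]
    have : ((N + 1) * (x l / ‖x‖) + 2 * η * N - 2 * (N * η)) * ‖x‖ ^ 2 =
      (N + 1) * (x l * ‖x‖) := by field_simp; ring
    rw [this]; exact main
  have : (1 + (N:ℝ) / 2) ^ 2 / ‖x‖ ^ 2 - (N + 1 + ε) / ‖x‖ ^ 2 =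
      ((N:ℝ) ^ 2 / 4 - ε) / ‖x‖ ^ 2 := by ring
  linarith

theorem stmt7 (N : ℕ) (hN : 2 ≤ N)
    (Ω : Set (EuclideanSpace ℝ (Fin N))) (hΩo : IsOpen Ω)
    (hΩb : Bornology.IsBounded Ω)
    (γ : ℝ) (hγ : γ < 0) (r : ℝ) (hr : 0 < r)
    (hloc : Ω ∩ Metric.ball 0 r ⊆ paraboloid N γ) :
    ∀ ε : ℝ, 0 < ε → ε < (N : ℝ) ^ 2 / 4 →
      ∃ C ≥ (0 : ℝ), ∀ v : EuclideanSpace ℝ (Fin N) → ℝ,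
        ContDiff ℝ (⊤ : ℕ∞) v → HasCompactSupport v → tsupport v ⊆ Ω →
        C * (∫ x in Ω, (v x) ^ 2) + (∫ x in Ω, ‖gradient v x‖ ^ 2) ≥
          ((N : ℝ) ^ 2 / 4 - ε) * ∫ x in Ω, (v x) ^ 2 / ‖x‖ ^ 2 := by
  intro ε hε _
  let l : Fin N := ⟨N - 1, by omega⟩
  have hlast : ∀ x : EuclideanSpace ℝ (Fin N), lastCoord x = x l := by
    intro x
    unfold lastCoord
    rw [Finset.sum_eq_single l]
    · rw [if_pos]; simp only [l]; omega
    · intro j _ hj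
      rw [if_neg]
      intro h
      apply hj
      ext
      simp only [l]; omega
    · simp
  have hsq : ∀ x : EuclideanSpace ℝ (Fin N), sqNormPrime x ≤ ‖x‖ ^ 2 := by
    intro x
    unfold sqNormPrime
    rw [EuclideanSpace.norm_sq_eq]
    refine Finset.sum_le_sum fun i _ => ?_
    split_ifs
    · simp
    · positivity
  have h0 : (0 : EuclideanSpace ℝ (Fin N)) ∉ Ω := by
    intro h
    have := hloc ⟨h, Metric.mem_ball_self hr⟩
    simp [paraboloid, sqNormPrime, lastCoord] at this
  have hN' : (2:ℝ) ≤ N := by exact_mod_cast hN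
  obtain ⟨η, hη⟩ : ∃ η : ℝ, η = ε / (N * (N + 1 + ε)) := ⟨_, rfl⟩
  have hη0 : 0 < η := by rw [hη]; positivity
  obtain ⟨ρ, hρ0, hρr, hργ⟩ : ∃ ρ : ℝ, 0 < ρ ∧ ρ < r ∧ -γ * ρ ≤ η / 2 := by
    refine ⟨min (r / 2) (η / 2 / (-γ)), ?_, ?_, ?_⟩
    · have : 0 < -γ := by linarith
      positivity
    · exact (min_le_left _ _).trans_lt (by linarith)
    · have h1 : 0 < -γ := by linarith
      have := min_le_right (r / 2) (η / 2 / (-γ))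
      rw [le_div_iff₀ h1] at this
      linarith
  have hcl : ∀ x ∈ closure Ω, ‖x‖ ≤ ρ → -(η / 2) * ‖x‖ ≤ x l := by
    intro x hx hxρ
    have h1 : x ∈ closure (Metric.ball 0 r ∩ Ω) :=
      Metric.isOpen_ball.inter_closure ⟨by simpa using hxρ.trans_lt hρr, hx⟩
    have h2 : closure (Metric.ball 0 r ∩ Ω) ⊆
        {y : EuclideanSpace ℝ (Fin N) | γ * ‖y‖ ^ 2 ≤ y l} := by
      refine closure_minimal ?_ (isClosed_le (by fun_prop) (by fun_prop))
      intro y hy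
      have h3 : γ * sqNormPrime y < lastCoord y := hloc ⟨hy.2, hy.1⟩
      rw [hlast] at h3
      have := hsq y
      show γ * ‖y‖ ^ 2 ≤ y l
      nlinarith
    have h3 : γ * ‖x‖ ^ 2 ≤ x l := h2 h1
    have h4 : -γ * ‖x‖ ≤ η / 2 := by nlinarith
    have := mul_le_mul_of_nonneg_right h4 (norm_nonneg x)
    nlinarith
  let χ : ContDiffBump (0 : EuclideanSpace ℝ (Fin N)) := ⟨ρ / 2, ρ, by positivity, by linarith⟩
  let F : Fin N → EuclideanSpace ℝ (Fin N) → ℝ := fun i => Ff η (N * η) (1 + (N:ℝ) / 2) l i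
  let G : Fin N → EuclideanSpace ℝ (Fin N) → ℝ := fun i x => χ x * F i x
  have hG : ∀ i, ∀ x ∈ closure Ω, x ≠ 0 → ContDiffAt ℝ 1 (G i) x := by
    intro i x hx hx0
    rcases le_or_gt ‖x‖ ρ with h | h
    · exact χ.contDiffAt.mul (Ff_contDiffAt η (N * η) _ l i x hx0
        (Pf_pos ε hε hN l η hη x hx0 (hcl x hx h)).ne')
    · refine (contDiffAt_const (c := (0:ℝ))).congr_of_eventuallyEq ?_
      have : ∀ᶠ y : EuclideanSpace ℝ (Fin N) in nhds x, ρ < ‖y‖ :=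
        continuous_norm.continuousAt.eventually (lt_mem_nhds h)
      filter_upwards [this] with y hy
      have : χ y = 0 := χ.zero_of_le_dist (by simpa [χ] using hy.le)
      simp [G, this]
  let f : EuclideanSpace ℝ (Fin N) → ℝ := fun x =>
    ∑ i, fderiv ℝ (G i) x (EuclideanSpace.single i 1) - ∑ i, (G i x) ^ 2 -
      ((N:ℝ) ^ 2 / 4 - ε) / ‖x‖ ^ 2
  have hK : IsCompact (closure Ω \ Metric.ball 0 (ρ / 2)) :=
    hΩb.isCompact_closure.diff Metric.isOpen_ball
  have hfc : ContinuousOn f (closure Ω \ Metric.ball 0 (ρ / 2)) := by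
    intro x hx
    have hx0 : x ≠ 0 := by
      rintro rfl
      exact hx.2 (Metric.mem_ball_self (by positivity))
    apply ContinuousAt.continuousWithinAt
    have c1 : ∀ i, ContinuousAt (fun x => fderiv ℝ (G i) x (EuclideanSpace.single i 1)) x :=
      fun i => (((hG i x hx.1 hx0).fderiv_right (m := 0) (by simp)).continuousAt).clm_apply
        continuousAt_const
    have c2 : ∀ i, ContinuousAt (fun x => (G i x) ^ 2) x := fun i =>
      (hG i x hx.1 hx0).continuousAt.pow 2
    have c3 : ContinuousAt (fun x : EuclideanSpace ℝ (Fin N) =>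
        ((N:ℝ) ^ 2 / 4 - ε) / ‖x‖ ^ 2) x :=
      continuousAt_const.div (by fun_prop) (by simpa using hx0)
    exact ((tendsto_finsetSum _ fun i _ => c1 i).sub (tendsto_finsetSum _ fun i _ => c2 i)).sub c3
  obtain ⟨C, hC⟩ := hK.exists_bound_of_continuousOn hfc
  refine ⟨max C 0, le_max_right _ _, ?_⟩
  intro v hv hc hs
  refine hardy_abstract Ω h0 G (fun i x hx => hG i x (subset_closure hx) (fun h => h0 (h ▸ hx)))
    _ _ ?_ v hv hc hs
  intro x hx
  have hx0 : x ≠ 0 := fun h => h0 (h ▸ hx)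
  by_cases hb : x ∈ Metric.ball (0 : EuclideanSpace ℝ (Fin N)) (ρ / 2)
  · have he : ∀ i, G i =ᶠ[nhds x] F i := by
      intro i
      filter_upwards [χ.eventuallyEq_one_of_mem_ball hb] with y hy
      simp [G, hy]
    have hxρ : ‖x‖ ≤ ρ := by
      have : ‖x‖ < ρ / 2 := by simpa using hb
      linarith
    have hxl := hcl x (subset_closure hx) hxρ
    have e1 : ∑ i, fderiv ℝ (G i) x (EuclideanSpace.single i 1) - ∑ i, (G i x) ^ 2 =
        ∑ i, fderiv ℝ (F i) x (EuclideanSpace.single i 1) - ∑ i, (F i x) ^ 2 := by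
      congr 1
      · exact Finset.sum_congr rfl fun i _ => by rw [(he i).fderiv_eq]
      · exact Finset.sum_congr rfl fun i _ => by rw [(he i).eq_of_nhds]
    have e2 := Ff_div η (N * η) l x hx0 (Pf_pos ε hε hN l η hη x hx0 hxl).ne'
    have e3 := Pf_key ε hε hN l η hη x hx0 hxl
    rw [e1]
    have e4 : ∑ i, fderiv ℝ (F i) x (EuclideanSpace.single i 1) - ∑ i, (F i x) ^ 2 ≥
        ((N:ℝ) ^ 2 / 4 - ε) / ‖x‖ ^ 2 := e2.symm ▸ e3
    have := le_max_right C 0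
    linarith
  · have h1 := hC x ⟨subset_closure hx, hb⟩
    have h2 := (abs_le.1 h1).1
    have h3 := le_max_left C 0
    simp only [f] at h2
    linarith
end

section
/- Let N ≥ 3 be an integer and let γ satisfy 0 < γ ≤ π/2. Then for every u ∈ A_γ: ∫₀^γ u'(θ)² (sin θ)^{N−2} dθ ≥ ((N−1)π²/(4γ²)) ∫₀^γ u(θ)² (sin θ)^{N−2} dθ. In particular the first Dirichlet eigenvalue λ₁(γ) of the spherical Laplacian on the spherical cap of aperture γ, characterized as λ₁(γ) = inf{∫₀^γ u'(θ)² (sin θ)^{N−2} dθ / ∫₀^γ u(θ)² (sin θ)^{N−2} dθ : u ∈ A_γ, u ≠ 0}, satisfies λ₁(γ) ≥ (N−1)π²/(4γ²). -/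
open Real MeasureTheory

/-- `A_γ`: smooth functions on `[0, γ]` (taken as smooth functions on `ℝ`)
vanishing on a neighborhood of `γ`. -/
def memA (γ : ℝ) (u : ℝ → ℝ) : Prop :=
  ContDiff ℝ (⊤ : ℕ∞) u ∧ ∃ η > (0 : ℝ), ∀ θ : ℝ, γ - η < θ → u θ = 0

/-- The first Dirichlet eigenvalue of the spherical Laplacian on the spherical
cap of aperture `γ`, characterized variationally. -/
noncomputable def lambda1 (N : ℕ) (γ : ℝ) : ℝ :=
  sInf {ρ : ℝ | ∃ u : ℝ → ℝ, memA γ u ∧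
    0 < (∫ θ in Set.Ioo 0 γ, (u θ) ^ 2 * Real.sin θ ^ (N - 2)) ∧
    ρ = (∫ θ in Set.Ioo 0 γ, (deriv u θ) ^ 2 * Real.sin θ ^ (N - 2)) /
        ∫ θ in Set.Ioo 0 γ, (u θ) ^ 2 * Real.sin θ ^ (N - 2)}

lemma tan_aux (a t : ℝ) (ha : 1 ≤ a) (ht : 0 ≤ t) (hat : a * t ≤ π / 2) :
    a * Real.cos (a * t) * Real.sin t ≤ Real.sin (a * t) * Real.cos t := by
  have hd : ∀ x, HasDerivAt (fun x => Real.sin (a * x) * Real.cos x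
      - a * Real.cos (a * x) * Real.sin x) ((a ^ 2 - 1) * (Real.sin (a * x) * Real.sin x)) x := by
    intro x
    have h0 : HasDerivAt (fun x : ℝ => a * x) a x := by
      simpa using (hasDerivAt_id x).const_mul a
    have h1 := h0.sin.mul (Real.hasDerivAt_cos x)
    have h2 := (h0.cos.const_mul a).mul (Real.hasDerivAt_sin x)
    refine (h1.sub h2).congr_deriv ?_
    ring
  have hm : MonotoneOn (fun x => Real.sin (a * x) * Real.cos x
      - a * Real.cos (a * x) * Real.sin x) (Set.Icc 0 t) := by
    apply monotoneOn_of_deriv_nonneg (convex_Icc 0 t)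
    · exact fun x _ => (hd x).continuousAt.continuousWithinAt
    · exact fun x _ => (hd x).differentiableAt.differentiableWithinAt
    · intro x hx
      rw [interior_Icc] at hx
      rw [(hd x).deriv]
      have hx0 : 0 < x := hx.1
      have h1 : a * x ≤ a * t := by nlinarith [hx.2]
      have h2 : x ≤ a * x := by nlinarith
      have s1 : 0 ≤ Real.sin (a * x) :=
        Real.sin_nonneg_of_nonneg_of_le_pi (by positivity) (by linarith [Real.pi_pos])
      have s2 : 0 ≤ Real.sin x :=
        Real.sin_nonneg_of_nonneg_of_le_pi hx0.le (by linarith [Real.pi_pos])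
      have : 0 ≤ a ^ 2 - 1 := by nlinarith
      positivity
  have := hm (Set.left_mem_Icc.2 ht) (Set.right_mem_Icc.2 ht) ht
  simp at this
  linarith

lemma main_ineq (m : ℕ) (γ : ℝ) (hγ0 : 0 < γ) (hγ : γ ≤ π / 2) (u : ℝ → ℝ) (hu : memA γ u) :
    (((m : ℝ) + 2) * π ^ 2 / (4 * γ ^ 2)) *
      (∫ θ in Set.Ioo 0 γ, (u θ) ^ 2 * Real.sin θ ^ (m + 1)) ≤
      ∫ θ in Set.Ioo 0 γ, (deriv u θ) ^ 2 * Real.sin θ ^ (m + 1) := by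
  obtain ⟨hs, η, hη, hz⟩ := hu
  set a : ℝ := π / (2 * γ) with ha
  have haγ : a * γ = π / 2 := by rw [ha]; field_simp
  have ha1 : 1 ≤ a := by
    rw [ha, le_div_iff₀ (by positivity)]; linarith
  have hlam : ((m : ℝ) + 2) * π ^ 2 / (4 * γ ^ 2) = (m + 2) * a ^ 2 := by
    rw [ha]; field_simp; ring
  rw [hlam]
  clear_value a
  have hcu : Continuous u := hs.continuous
  have hcd : Continuous (deriv u) := hs.continuous_deriv (by simp)
  have hdu : ∀ x, HasDerivAt u (deriv u x) x := fun x =>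
    (hs.differentiable (by simp) x).hasDerivAt
  have c1 : Continuous fun θ => (u θ) ^ 2 * Real.sin θ ^ (m + 1) := by fun_prop
  have c2 : Continuous fun θ => (deriv u θ) ^ 2 * Real.sin θ ^ (m + 1) := by fun_prop
  have c3 : Continuous fun θ => ((m + 2) * a ^ 2) * ((u θ) ^ 2 * Real.sin θ ^ (m + 1)) := by
    fun_prop
  rw [← integral_Ioc_eq_integral_Ioo, ← integral_Ioc_eq_integral_Ioo,
    ← intervalIntegral.integral_of_le hγ0.le, ← intervalIntegral.integral_of_le hγ0.le]
  have hcos : ∀ x, 0 ≤ x → x < γ → 0 < Real.cos (a * x) := by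
    intro x h0 h1
    apply Real.cos_pos_of_mem_Ioo
    have : a * x < a * γ := by nlinarith
    have : 0 ≤ a * x := by positivity
    constructor <;> linarith [Real.pi_pos]
  set F : ℝ → ℝ := fun x => (u x) ^ 2 * (-(a * Real.tan (a * x)) * Real.sin x ^ (m + 1)) with hF
  have hFd : ∀ x, 0 ≤ x → x < γ → HasDerivAt F
      (2 * u x * deriv u x * (-(a * Real.tan (a * x)) * Real.sin x ^ (m + 1))
       + (u x) ^ 2 * (-(a * (a / Real.cos (a * x) ^ 2)) * Real.sin x ^ (m + 1)
         + -(a * Real.tan (a * x)) * ((m + 1) * Real.sin x ^ m * Real.cos x))) x := by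
    intro x h0 h1
    have hc := hcos x h0 h1
    have h0 : HasDerivAt (fun x : ℝ => a * x) a x := by
      simpa using (hasDerivAt_id x).const_mul a
    have ht := ((Real.hasDerivAt_tan hc.ne').comp x h0).const_mul a |>.neg
    have hsn := (Real.hasDerivAt_sin x).pow (m + 1)
    refine (((hdu x).pow 2).mul (ht.mul hsn)).congr_deriv ?_
    simp only [Pi.mul_apply, Pi.pow_apply, Pi.neg_apply, Function.comp_apply,
      Nat.add_sub_cancel, Nat.cast_add, Nat.cast_one, Nat.cast_ofNat]
    ring
  have hFz : ∀ x, γ - η < x → F x = 0 := by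
    intro x hx; simp [hF, hz x hx]
  have key := intervalIntegral.sub_le_integral_of_hasDeriv_right_of_le (g := F)
    (φ := fun θ => (deriv u θ) ^ 2 * Real.sin θ ^ (m + 1)
      - ((m + 2) * a ^ 2) * ((u θ) ^ 2 * Real.sin θ ^ (m + 1))) hγ0.le
    (fun x hx => ?_) (fun x hx => (hFd x hx.1.le hx.2).hasDerivWithinAt)
    ((c2.sub c3).integrableOn_Icc) (fun x hx => ?_)
  · rw [intervalIntegral.integral_sub (c2.intervalIntegrable _ _)
      (c3.intervalIntegrable _ _),
      intervalIntegral.integral_const_mul, hFz γ (by linarith)] at key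
    have : F 0 = 0 := by simp [hF]
    rw [this] at key
    linarith
  · rcases hx.2.lt_or_eq with h | h
    · exact (hFd x hx.1 h).continuousAt.continuousWithinAt
    · have : F =ᶠ[nhds x] fun _ => (0 : ℝ) := by
        filter_upwards [Ioi_mem_nhds (show γ - η < x by linarith)] with y hy using hFz y hy
      exact (continuousAt_const.congr this.symm).continuousWithinAt
  · have hc := hcos x hx.1.le hx.2
    have hax : a * x ≤ π / 2 := by nlinarith [hx.2]
    have ht := tan_aux a x ha1 hx.1.le hax
    have hsin : 0 < Real.sin x :=
      Real.sin_pos_of_pos_of_lt_pi hx.1 (by linarith [hx.2, Real.pi_pos])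
    have hT : a * Real.sin x ≤ Real.tan (a * x) * Real.cos x := by
      rw [Real.tan_eq_sin_div_cos, div_mul_eq_mul_div, le_div_iff₀ hc]
      linarith
    have h1 : a / Real.cos (a * x) ^ 2 = a * (1 + Real.tan (a * x) ^ 2) := by
      rw [Real.tan_eq_sin_div_cos]; field_simp
      linarith [Real.sin_sq_add_cos_sq (a * x)]
    rw [h1]
    generalize Real.tan (a * x) = T at *
    have p1 : 0 ≤ Real.sin x ^ (m + 1) * (deriv u x + a * T * u x) ^ 2 := by positivity
    have p2 : 0 ≤ u x ^ 2 * a * (m + 1) * Real.sin x ^ m * (T * Real.cos x - a * Real.sin x) :=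
      mul_nonneg (by positivity) (by linarith)
    rw [← sub_nonneg]
    refine (add_nonneg p1 p2).trans_eq ?_
    ring

theorem stmt9 (N : ℕ) (hN : 3 ≤ N) (γ : ℝ) (hγ0 : 0 < γ) (hγ : γ ≤ π / 2) :
    (∀ u : ℝ → ℝ, memA γ u →
      (∫ θ in Set.Ioo 0 γ, (deriv u θ) ^ 2 * Real.sin θ ^ (N - 2)) ≥
        (((N : ℝ) - 1) * π ^ 2 / (4 * γ ^ 2)) *
          ∫ θ in Set.Ioo 0 γ, (u θ) ^ 2 * Real.sin θ ^ (N - 2)) ∧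
    lambda1 N γ ≥ ((N : ℝ) - 1) * π ^ 2 / (4 * γ ^ 2) := by
  have main : (∀ u : ℝ → ℝ, memA γ u →
      (∫ θ in Set.Ioo 0 γ, (deriv u θ) ^ 2 * Real.sin θ ^ (N - 2)) ≥
        (((N : ℝ) - 1) * π ^ 2 / (4 * γ ^ 2)) *
          ∫ θ in Set.Ioo 0 γ, (u θ) ^ 2 * Real.sin θ ^ (N - 2)) := by
    intro u hu
    obtain ⟨m, rfl⟩ := Nat.exists_eq_add_of_le hN
    have h := main_ineq m γ hγ0 hγ u hu
    have e1 : 3 + m - 2 = m + 1 := by omega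
    have e2 : ((3 + m : ℕ) : ℝ) - 1 = m + 2 := by push_cast; ring
    rw [e1, e2]
    exact h
  refine ⟨main, ?_⟩
  apply le_csInf
  · have hm : memA γ (fun θ => Real.smoothTransition (γ / 2 - θ)) := by
      refine ⟨?_, γ / 2, by positivity, fun θ hθ => ?_⟩
      · exact Real.smoothTransition.contDiff.comp (contDiff_const.sub contDiff_id)
      · exact Real.smoothTransition.zero_of_nonpos (by linarith)
    refine ⟨_, _, hm, ?_, rfl⟩
    rw [← integral_Ioc_eq_integral_Ioo, ← intervalIntegral.integral_of_le hγ0.le]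
    have hc := hm.1.continuous
    have hsin : ∀ x, 0 < x → x ≤ γ → 0 < Real.sin x := fun x h0 h1 =>
      Real.sin_pos_of_pos_of_lt_pi h0 (by linarith [Real.pi_pos])
    apply intervalIntegral.integral_pos hγ0
    · exact ((hc.pow 2).mul (Real.continuous_sin.pow _)).continuousOn
    · intro x hx
      have := hsin x hx.1 hx.2
      positivity
    · refine ⟨γ / 4, ⟨by linarith, by linarith⟩, ?_⟩
      have h1 := hsin (γ / 4) (by linarith) (by linarith)
      have h2 : 0 < Real.smoothTransition (γ / 2 - γ / 4) :=
        Real.smoothTransition.pos_of_pos (by linarith)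
      positivity
  · rintro ρ ⟨u, hu, hpos, rfl⟩
    rw [le_div_iff₀ hpos]
    exact main u hu
end

section
/- Let N ≥ 3 be an integer. For every ε > 0 there exists δ > 0 such that for every γ with π/2 ≤ γ ≤ π/2 + δ and every u ∈ A_γ: ∫₀^γ u'(θ)² (sin θ)^{N−2} dθ ≥ (N−1−ε) ∫₀^γ u(θ)² (sin θ)^{N−2} dθ. In particular the first Dirichlet eigenvalue λ₁(γ) = inf{∫₀^γ u'(θ)² (sin θ)^{N−2} dθ / ∫₀^γ u(θ)² (sin θ)^{N−2} dθ : u ∈ A_γ, u ≠ 0} satisfies λ₁(γ) ≥ N − 1 − ε for all γ ∈ [π/2, π/2 + δ]. -/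
open Real MeasureTheory

lemma aux_alg (n e d x : ℝ) (hn : 3 ≤ n) (he : 0 < e) (he1 : e ≤ 1)
    (hd : d = e / (8 * n * (n + 2))) (hx : -d ≤ x) (hx1 : x ≤ 1) :
    0 < x + 2 * d * (1 - n * x ^ 2) ∧
    0 ≤ e * x + 2 * d * (n + 1 + e) * (1 - n * x ^ 2) := by
  have hpos : 0 < 8 * n * (n + 2) := by positivity
  have hd0 : 0 < d := by rw [hd]; positivity
  have hde : d * (8 * n * (n + 2)) = e := by rw [hd]; field_simp
  have hnd0 : 0 < n * d := by positivity
  have hnd : n * d ≤ 1 / 40 := by nlinarith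
  have hd1 : d ≤ 1 / 120 := by nlinarith
  rcases le_total x 0 with h | h
  · have hx2 : x ^ 2 ≤ d ^ 2 := by nlinarith
    have h1 : n * x ^ 2 ≤ 1 / 4 := by nlinarith
    refine ⟨by nlinarith, ?_⟩
    have h2 : d * (n + 1 + e) * (3 / 4) ≤ d * (n + 1 + e) * (1 - n * x ^ 2) := by
      apply mul_le_mul_of_nonneg_left (by linarith) (by positivity)
    have h3 : -d ≤ e * x := by nlinarith
    nlinarith
  · have hx2 : x ^ 2 ≤ x := by nlinarith
    have h1 : n * d * x ^ 2 ≤ n * d * x := mul_le_mul_of_nonneg_left hx2 hnd0.le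
    refine ⟨by nlinarith, ?_⟩
    have h2 : n * d * (n + 1 + e) * x ^ 2 ≤ n * d * (n + 1 + e) * x :=
      mul_le_mul_of_nonneg_left hx2 (by positivity)
    have h3 : 2 * (n * d * (n + 1 + e)) ≤ e := by nlinarith
    have h4 : 0 < d * (n + 1 + e) := by positivity
    nlinarith [mul_le_mul_of_nonneg_right h3 h]

lemma main_ineq_s10 (N : ℕ) (hN : 3 ≤ N) (ε e d γ : ℝ) (he : 0 < e) (he1 : e ≤ 1) (hee : e ≤ ε)
    (hd : d = e / (8 * N * (N + 2))) (hγ : π / 2 ≤ γ) (hγ2 : γ ≤ π / 2 + d) (hγπ : γ ≤ π)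
    (u : ℝ → ℝ) (hu : memA γ u) :
    (∫ θ in Set.Ioo 0 γ, (deriv u θ) ^ 2 * Real.sin θ ^ (N - 2)) ≥
            ((N : ℝ) - 1 - ε) *
              ∫ θ in Set.Ioo 0 γ, (u θ) ^ 2 * Real.sin θ ^ (N - 2) := by
  obtain ⟨hs, η, hη, hz⟩ := hu
  obtain ⟨m, rfl⟩ : ∃ m, N = m + 2 := ⟨N - 2, by omega⟩
  simp only [Nat.add_sub_cancel]
  set n : ℝ := ((m + 2 : ℕ) : ℝ) with hn
  have hn3 : (3 : ℝ) ≤ n := by rw [hn]; exact_mod_cast hN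
  have hm : (m : ℝ) = n - 2 := by rw [hn]; push_cast; ring
  have hγ0 : 0 < γ := by linarith [pi_pos]
  have hc : ∀ θ ∈ Set.Icc 0 γ, -d ≤ cos θ := by
    intro θ hθ
    rcases le_total θ (π / 2) with h | h
    · have := cos_nonneg_of_neg_pi_div_two_le_of_le (by linarith [pi_pos, hθ.1]) h
      have : 0 < d := by rw [hd]; positivity
      linarith
    · have h1 : sin (θ - π / 2) ≤ θ - π / 2 := sin_le (by linarith)
      rw [sin_sub_pi_div_two] at h1
      linarith [hθ.2]
  have hal := fun θ hθ => aux_alg n e d (cos θ) hn3 he he1 hd (hc θ hθ) (cos_le_one θ)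
  have hdu : Continuous (deriv u) := hs.continuous_deriv (by norm_cast)
  have hcu : Continuous u := hs.continuous
  have hD : ∀ θ, HasDerivAt u (deriv u θ) θ := fun θ =>
    ((hs.differentiable (by simp)) θ).hasDerivAt
  set q : ℝ → ℝ := fun θ => cos θ + 2 * d * (1 - n * cos θ ^ 2) with hq
  set p : ℝ → ℝ := fun θ => 1 - 4 * d * n * cos θ with hp
  set F : ℝ → ℝ := fun θ => -(u θ ^ 2 * (sin θ ^ (m + 1) * p θ / q θ)) with hF
  set F' : ℝ → ℝ := fun θ => -(2 * u θ * deriv u θ * (sin θ ^ (m + 1) * p θ / q θ) +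
    u θ ^ 2 * ((((n - 1) * sin θ ^ m * cos θ * p θ + sin θ ^ (m + 1) * (4 * d * n * sin θ)) * q θ
      - sin θ ^ (m + 1) * p θ * (-sin θ * p θ)) / q θ ^ 2)) with hF'
  have hder : ∀ θ ∈ Set.Icc 0 γ, HasDerivAt F (F' θ) θ := by
    intro θ hθ
    have hq0 : q θ ≠ 0 := (hal θ hθ).1.ne'
    have h1 : HasDerivAt q (-sin θ * p θ) θ := by
      have := (hasDerivAt_cos θ).add
        ((((hasDerivAt_cos θ).pow 2).const_mul n).const_sub 1 |>.const_mul (2 * d))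
      refine HasDerivAt.congr_deriv this ?_
      simp only [hp]; push_cast; ring
    have h2 : HasDerivAt p (4 * d * n * sin θ) θ := by
      have := ((hasDerivAt_cos θ).const_mul (4 * d * n)).const_sub 1
      refine HasDerivAt.congr_deriv this ?_
      ring
    have h3 : HasDerivAt (fun θ => sin θ ^ (m + 1)) ((n - 1) * sin θ ^ m * cos θ) θ := by
      have := (hasDerivAt_sin θ).pow (m + 1)
      refine HasDerivAt.congr_deriv this ?_
      simp only [Nat.add_sub_cancel]; push_cast; rw [hm]; ring
    have h4 : HasDerivAt (fun θ => u θ ^ 2) (2 * u θ * deriv u θ) θ := by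
      have := (hD θ).pow 2
      refine HasDerivAt.congr_deriv this ?_
      push_cast; ring
    have := (h4.mul ((h3.mul h2).div h1 hq0)).neg
    exact this
  have hqc : Continuous q := by fun_prop
  have hpc : Continuous p := by fun_prop
  have hF'c : ContinuousOn F' (Set.Icc 0 γ) := by
    have hq0 : ∀ θ ∈ Set.Icc 0 γ, q θ ≠ 0 := fun θ hθ => (hal θ hθ).1.ne'
    apply ContinuousOn.neg
    apply ContinuousOn.add
    · apply ContinuousOn.mul (by fun_prop)
      exact ContinuousOn.div (by fun_prop) (by fun_prop) hq0
    · apply ContinuousOn.mul (by fun_prop)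
      exact ContinuousOn.div (by fun_prop) (by fun_prop) (fun θ hθ => pow_ne_zero _ (hq0 θ hθ))
  have hFi : IntervalIntegrable F' volume 0 γ := by
    apply ContinuousOn.intervalIntegrable
    rwa [Set.uIcc_of_le hγ0.le]
  have hint : ∫ θ in (0 : ℝ)..γ, F' θ = 0 := by
    rw [intervalIntegral.integral_eq_sub_of_hasDerivAt (f := F) _ hFi]
    · simp [hF, hz γ (by linarith)]
    · rw [Set.uIcc_of_le hγ0.le]; exact hder
  have hconv : ∀ f : ℝ → ℝ, ∫ θ in Set.Ioo 0 γ, f θ = ∫ θ in (0 : ℝ)..γ, f θ := by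
    intro f
    rw [intervalIntegral.integral_of_le hγ0.le, integral_Ioc_eq_integral_Ioo]
  rw [hconv, hconv]
  have hle : ∫ θ in (0 : ℝ)..γ, (((n - 1 - ε) * (u θ ^ 2 * sin θ ^ m)) + F' θ) ≤
      ∫ θ in (0 : ℝ)..γ, (deriv u θ ^ 2 * sin θ ^ m) := by
    apply intervalIntegral.integral_mono_on hγ0.le
    · exact IntervalIntegrable.add (Continuous.intervalIntegrable (by fun_prop) _ _) hFi
    · exact Continuous.intervalIntegrable (by fun_prop) _ _
    intro θ hθ
    obtain ⟨hq0, hk⟩ := hal θ hθ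
    change 0 < q θ at hq0
    have hsin : 0 ≤ sin θ := sin_nonneg_of_nonneg_of_le_pi hθ.1 (hθ.2.trans hγπ)
    have hk' : 0 ≤ ((n - 1) * cos θ * p θ + sin θ ^ 2 * (4 * d * n)) / q θ - (n - 1 - ε) := by
      rw [sub_nonneg, le_div_iff₀ hq0]
      have h1 : (n - 1 - ε) * q θ ≤ (n - 1 - e) * q θ :=
        mul_le_mul_of_nonneg_right (by linarith) hq0.le
      refine h1.trans ?_
      rw [sin_sq]
      simp only [hp, hq]
      linarith
    have key : deriv u θ ^ 2 * sin θ ^ m - (((n - 1 - ε) * (u θ ^ 2 * sin θ ^ m)) + F' θ) =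
      sin θ ^ m * ((deriv u θ + u θ * sin θ * p θ / q θ) ^ 2 + u θ ^ 2 *
        (((n - 1) * cos θ * p θ + sin θ ^ 2 * (4 * d * n)) / q θ - (n - 1 - ε))) := by
      simp only [hF']
      generalize q θ = Q at *
      generalize p θ = P at *
      field_simp
      ring
    have : 0 ≤ deriv u θ ^ 2 * sin θ ^ m - (((n - 1 - ε) * (u θ ^ 2 * sin θ ^ m)) + F' θ) := by
      rw [key]; positivity
    linarith
  rw [intervalIntegral.integral_add (Continuous.intervalIntegrable (by fun_prop) _ _) hFi, hint,
    intervalIntegral.integral_const_mul, add_zero] at hle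
  exact hle

lemma exists_test (N : ℕ) (γ : ℝ) (hγ : π / 2 ≤ γ) (hγπ : γ ≤ π) :
    ∃ u : ℝ → ℝ, memA γ u ∧
      0 < ∫ θ in Set.Ioo 0 γ, (u θ) ^ 2 * Real.sin θ ^ (N - 2) := by
  have h3 := pi_gt_three
  have hγ0 : 0 < γ := by linarith
  have hsm : ContDiff ℝ (⊤ : ℕ∞) (fun θ : ℝ => smoothTransition (γ - 1 / 4 - θ)) :=
    Real.smoothTransition.contDiff.comp (contDiff_const.sub contDiff_id)
  refine ⟨fun θ => smoothTransition (γ - 1 / 4 - θ), ⟨hsm, 1 / 4, by norm_num, ?_⟩, ?_⟩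
  · intro θ hθ
    exact smoothTransition.zero_of_nonpos (by linarith)
  · rw [← integral_Ioc_eq_integral_Ioo, ← intervalIntegral.integral_of_le hγ0.le]
    apply intervalIntegral.integral_pos hγ0
    · have := hsm.continuous
      fun_prop
    · intro x hx
      have := sin_nonneg_of_nonneg_of_le_pi hx.1.le (hx.2.trans hγπ)
      positivity
    · refine ⟨1, ⟨by norm_num, by linarith⟩, ?_⟩
      have h1 : 0 < sin 1 := sin_pos_of_pos_of_lt_pi (by norm_num) (by linarith)
      have h2 : 0 < smoothTransition (γ - 1 / 4 - 1) := smoothTransition.pos_of_pos (by linarith)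
      positivity

theorem stmt10 (N : ℕ) (hN : 3 ≤ N) :
    ∀ ε : ℝ, 0 < ε → ∃ δ : ℝ, 0 < δ ∧
      ∀ γ : ℝ, π / 2 ≤ γ → γ ≤ π / 2 + δ →
        (∀ u : ℝ → ℝ, memA γ u →
          (∫ θ in Set.Ioo 0 γ, (deriv u θ) ^ 2 * Real.sin θ ^ (N - 2)) ≥
            ((N : ℝ) - 1 - ε) *
              ∫ θ in Set.Ioo 0 γ, (u θ) ^ 2 * Real.sin θ ^ (N - 2)) ∧
        lambda1 N γ ≥ (N : ℝ) - 1 - ε := by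
  intro ε hε
  have he : 0 < min ε 1 := lt_min hε one_pos
  have hN' : (3 : ℝ) ≤ N := by exact_mod_cast hN
  have hpos : (0 : ℝ) < 8 * N * (N + 2) := by positivity
  refine ⟨min ε 1 / (8 * N * (N + 2)), by positivity, ?_⟩
  intro γ hγ hγ2
  have hγπ : γ ≤ π := by
    have : min ε 1 / (8 * N * (N + 2)) ≤ 1 := by
      rw [div_le_one hpos]
      have := min_le_right ε 1
      nlinarith
    linarith [pi_gt_three]
  have hmain := main_ineq_s10 N hN ε _ _ γ he (min_le_right _ _) (min_le_left _ _) rfl hγ hγ2 hγπ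
  refine ⟨hmain, ?_⟩
  obtain ⟨u, hu, hup⟩ := exists_test N γ hγ hγπ
  unfold lambda1
  refine ge_iff_le.mpr (le_csInf ⟨_, u, hu, hup, rfl⟩ ?_)
  rintro ρ ⟨v, hv, hvp, rfl⟩
  rw [le_div_iff₀ hvp]
  exact hmain v hv
end
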